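/- arXiv:1901.03048 — 2 statements merged into one kernel-verified Lean document; each statement's English description precedes it below -/
import Mathlib

section
/- The space (M^∞, OT_∞) is complete, where M^∞ is the set of Radon measures on Ω whose support lies at bounded distance from the diagonal, and OT_∞(μ,ν) is the infimum over admissible partial transport plans π of the essential supremum sup{d(x,y) : (x,y) ∈ spt(π)}. -/
noncomputable section

open MeasureTheory Metric Set Filter Topology ENNReal
open scoped Classical

/-- The plane with the Euclidean distance. -/
abbrev Pt : Type := EuclideanSpace ℝ (Fin 2)

/-- Build a point of the plane from coordinates. -/
def mk2 (a b : ℝ) : Pt := (WithLp.equiv 2 (Fin 2 → ℝ)).symm ![a, b]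

/-- The open upper half-plane Ω = {(t₁,t₂) : t₂ > t₁}. -/
def UHP : Set Pt := {x | x 0 < x 1}

/-- The diagonal ∂Ω = {(t,t)}. -/
def Diag : Set Pt := {x | x 0 = x 1}

/-- Ω̄ = Ω ∪ ∂Ω. -/
def UHPbar : Set Pt := UHP ∪ Diag

/-- Distance from a point to the diagonal. -/
def persDist (x : Pt) : ℝ := infDist x Diag

/-- p-th total persistence Pers_p(μ) = ∫_Ω d(x,∂Ω)^p dμ(x). -/
def Pers (p : ℝ) (μ : Measure Pt) : ℝ≥0∞ :=
  ∫⁻ x in UHP, ENNReal.ofReal (persDist x ^ p) ∂μ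

/-- μ ∈ M^p : a measure supported on Ω with finite p-th persistence. -/
def MemMp (p : ℝ) (μ : Measure Pt) : Prop := μ UHPᶜ = 0 ∧ Pers p μ < ⊤

/-- Admissible partial transport plans between μ and ν: measures on Ω̄ × Ω̄ whose
marginals restricted to Ω are μ and ν. -/
def Adm (μ ν : Measure Pt) : Set (Measure (Pt × Pt)) :=
  {π | π ((UHPbar ×ˢ UHPbar)ᶜ) = 0 ∧
    (∀ A : Set Pt, MeasurableSet A → A ⊆ UHP → π (A ×ˢ univ) = μ A) ∧
    (∀ B : Set Pt, MeasurableSet B → B ⊆ UHP → π (univ ×ˢ B) = ν B)}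

/-- Cost C_p(π) = ∬ d(x,y)^p dπ(x,y). -/
def Cost (p : ℝ) (π : Measure (Pt × Pt)) : ℝ≥0∞ :=
  ∫⁻ z, ENNReal.ofReal (dist z.1 z.2 ^ p) ∂π

/-- OT_p(μ,ν)^p, as an extended real. -/
def OTe (p : ℝ) (μ ν : Measure Pt) : ℝ≥0∞ := ⨅ π ∈ Adm μ ν, Cost p π

/-- The optimal partial transport distance OT_p(μ,ν). -/
def OT (p : ℝ) (μ ν : Measure Pt) : ℝ := (OTe p μ ν ^ (1 / p)).toReal

/-- Optimal plans. -/
def OptSet (p : ℝ) (μ ν : Measure Pt) : Set (Measure (Pt × Pt)) :=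
  {π | π ∈ Adm μ ν ∧ Cost p π = OTe p μ ν}

/-- Vague convergence of measures on Ω: convergence of integrals of continuous
functions compactly supported in Ω. -/
def VagueTendsto (μs : ℕ → Measure Pt) (μ : Measure Pt) : Prop :=
  ∀ f : Pt → ℝ, Continuous f → HasCompactSupport f → tsupport f ⊆ UHP →
    Tendsto (fun n => ∫ x, f x ∂(μs n)) atTop (𝓝 (∫ x, f x ∂μ))

/-- E_Ω = (Ω̄ × Ω̄) \ (∂Ω × ∂Ω). -/
def EOm : Set (Pt × Pt) := (UHPbar ×ˢ UHPbar) \ (Diag ×ˢ Diag)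

/-- Vague convergence of plans on E_Ω. -/
def VaguePlanTendsto (πs : ℕ → Measure (Pt × Pt)) (π : Measure (Pt × Pt)) : Prop :=
  ∀ f : Pt × Pt → ℝ, Continuous f → HasCompactSupport f → tsupport f ⊆ EOm →
    Tendsto (fun n => ∫ z, f z ∂(πs n)) atTop (𝓝 (∫ z, f z ∂π))

/-- A persistence diagram: an ℕ-valued point measure Σ_{x ∈ X} n_x δ_x with
X ⊆ Ω locally finite in Ω. -/
def IsDiagram (μ : Measure Pt) : Prop :=
  ∃ (X : Set Pt) (n : Pt → ℕ), X ⊆ UHP ∧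
    (∀ x ∈ UHP, ∃ U ∈ 𝓝 x, (X ∩ U).Finite) ∧
    μ = Measure.sum (fun x : X => (n x.1 : ℝ≥0∞) • Measure.dirac (x.1 : Pt))

/-- Support of a measure on Pt × Pt. -/
def msupp (π : Measure (Pt × Pt)) : Set (Pt × Pt) := {z | ∀ U ∈ 𝓝 z, π U ≠ 0}

/-- Support of a measure on Pt. -/
def suppM (μ : Measure Pt) : Set Pt := {x | ∀ U ∈ 𝓝 x, μ U ≠ 0}

/-- Bottleneck cost of a plan: sup of d(x,y) over the support. -/
def CostInf (π : Measure (Pt × Pt)) : ℝ≥0∞ :=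
  ⨆ z ∈ msupp π, ENNReal.ofReal (dist z.1 z.2)

/-- The bottleneck (∞) optimal partial transport distance, as extended real. -/
def OTinfE (μ ν : Measure Pt) : ℝ≥0∞ := ⨅ π ∈ Adm μ ν, CostInf π

/-- μ ∈ M^∞ : support at bounded distance from the diagonal. -/
def MemMinf (μ : Measure Pt) : Prop :=
  μ UHPᶜ = 0 ∧ ∃ C : ℝ, ∀ x ∈ suppM μ, persDist x ≤ C

/-- A partial matching between two indexed families: a bijection between
subsets of the index sets; unmatched points are sent to the diagonal. -/
structure Matching (ι κ : Type*) where
  I : Set ι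
  J : Set κ
  e : I ≃ J

/-- Cost of a partial matching for d_p (as the p-th power, extended real). -/
def mCost (p : ℝ) {ι κ : Type*} (x : ι → Pt) (y : κ → Pt) (m : Matching ι κ) : ℝ≥0∞ :=
  (∑' i : m.I, ENNReal.ofReal (dist (x i.1) (y (m.e i).1) ^ p))
  + (∑' i : ↥(m.Iᶜ), ENNReal.ofReal (persDist (x i.1) ^ p))
  + (∑' j : ↥(m.Jᶜ), ENNReal.ofReal (persDist (y j.1) ^ p))

/-- Bottleneck cost of a partial matching. -/
def mCostInf {ι κ : Type*} (x : ι → Pt) (y : κ → Pt) (m : Matching ι κ) : ℝ≥0∞ :=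
  (⨆ i : m.I, ENNReal.ofReal (dist (x i.1) (y (m.e i).1)))
  ⊔ (⨆ i : ↥(m.Iᶜ), ENNReal.ofReal (persDist (x i.1)))
  ⊔ (⨆ j : ↥(m.Jᶜ), ENNReal.ofReal (persDist (y j.1)))

/-- The point measure associated to an indexed family of points. -/
def famMeasure {ι : Type*} (x : ι → Pt) : Measure Pt :=
  Measure.sum (fun i => Measure.dirac (x i))

/-- The weighted measure μ^p, with density d(x,∂Ω)^p with respect to μ. -/
def wgt (p : ℝ) (μ : Measure Pt) : Measure Pt :=
  μ.withDensity (fun x => ENNReal.ofReal (persDist x ^ p))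

/-- The quotient space Ω̃ = Ω ⊔ {∂Ω}. -/
def Qt : Type := Option ↥UHP

/-- The quotient metric ρ on Ω̃. -/
def ρQ : Qt → Qt → ℝ
  | some x, some y => min (dist (x : Pt) (y : Pt)) (persDist x + persDist y)
  | some x, none => persDist x
  | none, some y => persDist y
  | none, none => 0

/-- The quotient metric ρ viewed on the plane, all diagonal points being
identified. -/
def ρP (x y : Pt) : ℝ :=
  if x ∈ Diag then (if y ∈ Diag then 0 else persDist y)
  else if y ∈ Diag then persDist x
  else min (dist x y) (persDist x + persDist y)

/-- Couplings with full (equal-mass) marginals. -/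
def Coup (μ ν : Measure Pt) : Set (Measure (Pt × Pt)) :=
  {π | π.map Prod.fst = μ ∧ π.map Prod.snd = ν}

/-- The p-Wasserstein distance (to the p) for the quotient metric ρ. -/
def WpE (p : ℝ) (μ ν : Measure Pt) : ℝ≥0∞ :=
  ⨅ π ∈ Coup μ ν, ∫⁻ z, ENNReal.ofReal (ρP z.1 z.2 ^ p) ∂π



section RMK
open scoped NNReal CompactlySupported

variable {X : Type*} [TopologicalSpace X] [T2Space X] [LocallyCompactSpace X]
  [MeasurableSpace X] [BorelSpace X]

lemma ulim_exists (U : Ultrafilter ℕ) (g : ℕ → ℝ≥0∞) :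
    ∃ l, Tendsto g U (𝓝 l) := by
  have h := (U.map g).le_nhds_lim
  exact ⟨_, h⟩

lemma cc_meas (f : C_c(X, ℝ≥0)) : Measurable (fun x => (f x : ℝ≥0∞)) := by
  have h : Measurable (fun x => f x) := f.continuous.measurable
  exact h.coe_nnreal_ennreal

lemma exists_ulim_measure (U : Ultrafilter ℕ) (α : ℕ → Measure X)
    (hα : ∀ K : Set X, IsCompact K → ∃ M : ℝ≥0∞, M < ⊤ ∧ ∀ᶠ m in (U : Filter ℕ), α m K ≤ M) :
    ∃ b : Measure X, b.Regular ∧ ∀ f : C_c(X, ℝ≥0),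
      Tendsto (fun m => ∫⁻ x, f x ∂(α m)) U (𝓝 (∫⁻ x, f x ∂b)) := by
  choose L hL using fun f : C_c(X, ℝ≥0) => ulim_exists U (fun m => ∫⁻ x, f x ∂(α m))
  have hmeas : ∀ f : C_c(X, ℝ≥0), Measurable (fun x => (f x : ℝ≥0∞)) := fun f =>
    (f.continuous.measurable).coe_nnreal_ennreal
  have hfin : ∀ f, L f ≠ ⊤ := by
    intro f
    obtain ⟨M, hM, hev⟩ := hα _ f.hasCompactSupport
    obtain ⟨C, hC⟩ : ∃ C : ℝ≥0, ∀ x, f x ≤ C := by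
      obtain ⟨C, hC⟩ := (f.hasCompactSupport.isCompact_range f.continuous).bddAbove
      exact ⟨C, fun x => hC ⟨x, rfl⟩⟩
    have : L f ≤ C * M := by
      refine le_of_tendsto (hL f) (hev.mono fun m hm => ?_)
      calc ∫⁻ x, f x ∂(α m) ≤ ∫⁻ x, (tsupport f).indicator (fun _ => (C : ℝ≥0∞)) x ∂(α m) := by
            refine lintegral_mono fun x => ?_
            by_cases hx : x ∈ tsupport f
            · simp only [indicator_of_mem hx]; exact_mod_cast hC x
            · simp [image_eq_zero_of_notMem_tsupport hx]
        _ = C * α m (tsupport f) := by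
            rw [lintegral_indicator (isClosed_tsupport _).measurableSet]; simp
        _ ≤ C * M := by gcongr
    exact ne_top_of_le_ne_top (ENNReal.mul_ne_top ENNReal.coe_ne_top hM.ne) this
  let Λ : C_c(X, ℝ≥0) →ₗ[ℝ≥0] ℝ≥0 :=
    { toFun := fun f => (L f).toNNReal
      map_add' := by
        intro f g
        rw [← ENNReal.toNNReal_add (hfin f) (hfin g)]
        congr 1
        refine tendsto_nhds_unique (hL (f + g)) ?_
        refine ((hL f).add (hL g)).congr fun m => ?_
        rw [← lintegral_add_left (hmeas f)]
        simp
      map_smul' := by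
        intro c f
        have : L (c • f) = c * L f := by
          refine tendsto_nhds_unique (hL (c • f)) ?_
          refine (ENNReal.Tendsto.const_mul (hL f) (Or.inr ENNReal.coe_ne_top)).congr fun m => ?_
          rw [← lintegral_const_mul _ (hmeas f)]
          simp
        simp [this] }
  refine ⟨NNRealRMK.rieszMeasure Λ, inferInstance, fun f => ?_⟩
  rw [NNRealRMK.lintegral_rieszMeasure]
  have : ((Λ f : ℝ≥0) : ℝ≥0∞) = L f := ENNReal.coe_toNNReal (hfin f)
  rw [this]
  exact hL f

/-- `b` is a limit of `α` along `U`. -/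
def IsULim (U : Ultrafilter ℕ) (α : ℕ → Measure X) (b : Measure X) : Prop :=
  ∀ f : C_c(X, ℝ≥0), Tendsto (fun m => ∫⁻ x, f x ∂(α m)) U (𝓝 (∫⁻ x, f x ∂b))

lemma exists_bump {K V : Set X} (hK : IsCompact K) (hV : IsOpen V) (hKV : K ⊆ V) :
    ∃ f : C_c(X, ℝ≥0), (∀ x ∈ K, f x = 1) ∧ (∀ x, f x ≤ 1) ∧ (∀ x ∉ V, f x = 0) := by
  obtain ⟨f, hf1, hf2, hf3, hf4⟩ := exists_continuousMap_one_of_isCompact_subset_isOpen hK hV hKV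
  have hcs : HasCompactSupport (fun x => Real.toNNReal (f x)) :=
    HasCompactSupport.comp_left (g := Real.toNNReal) hf2 (by simp)
  refine ⟨⟨⟨fun x => Real.toNNReal (f x), by fun_prop⟩, hcs⟩, ?_, ?_, ?_⟩
  · intro x hx
    have : f x = 1 := hf1 hx
    change Real.toNNReal (f x) = 1
    simp [this]
  · intro x
    change Real.toNNReal (f x) ≤ 1
    simpa using (hf4 x).2
  · intro x hx
    change Real.toNNReal (f x) = 0
    have : f x = 0 := by
      by_contra h
      exact hx (hf3 (subset_tsupport _ h))
    simp [this]

lemma IsULim.null {U : Ultrafilter ℕ} {α : ℕ → Measure X} {b : Measure X} [b.Regular]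
    (h : IsULim U α b) {V : Set X} (hV : IsOpen V) (h0 : ∀ᶠ m in (U : Filter ℕ), α m V = 0) :
    b V = 0 := by
  rw [hV.measure_eq_iSup_isCompact]
  simp only [ENNReal.iSup_eq_zero]
  intro K hKV hK
  obtain ⟨f, h1, -, h3⟩ := exists_bump hK hV hKV
  have hz : ∫⁻ x, f x ∂b = 0 := by
    refine tendsto_nhds_unique (h f) (tendsto_const_nhds.congr' (h0.mono fun m hm => ?_))
    symm
    refine (lintegral_eq_zero_iff (cc_meas f)).2 ?_
    refine measure_mono_null ?_ hm
    intro x hx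
    by_contra hxV
    exact hx (by simp [h3 x hxV])
  refine le_antisymm ?_ bot_le
  change b K ≤ 0
  rw [← hz]
  calc b K = ∫⁻ x, K.indicator 1 x ∂b := by rw [lintegral_indicator_one hK.measurableSet]
    _ ≤ _ := lintegral_mono fun x => by
      by_cases hx : x ∈ K <;> simp [hx, h1 x]

lemma IsULim.exists_lt {U : Ultrafilter ℕ} {α : ℕ → Measure X} {b : Measure X} [b.Regular]
    (h : IsULim U α b) {r : ℝ≥0∞} (hr : r < b univ) :
    ∃ f : C_c(X, ℝ≥0), (∀ x, f x ≤ 1) ∧ ∀ᶠ m in (U : Filter ℕ),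
      r < ∫⁻ x, f x ∂(α m) ∧ ∫⁻ x, f x ∂(α m) < ⊤ := by
  rw [isOpen_univ.measure_eq_iSup_isCompact] at hr
  simp only [lt_iSup_iff] at hr
  obtain ⟨K, -, hK, hrK⟩ := hr
  obtain ⟨f, h1, h2, -⟩ := exists_bump hK isOpen_univ (subset_univ K)
  refine ⟨f, h2, ?_⟩
  have hb : b K ≤ ∫⁻ x, f x ∂b := by
    calc b K = ∫⁻ x, K.indicator 1 x ∂b := by rw [lintegral_indicator_one hK.measurableSet]
    _ ≤ _ := lintegral_mono fun x => by
      by_cases hx : x ∈ K <;> simp [hx, h1 x]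
  have hfin : ∫⁻ x, f x ∂b < ⊤ := by
    calc ∫⁻ x, f x ∂b ≤ ∫⁻ x, (tsupport f).indicator 1 x ∂b := by
          refine lintegral_mono fun x => ?_
          by_cases hx : x ∈ tsupport f
          · simp only [indicator_of_mem hx]; exact ENNReal.coe_le_one_iff.2 (h2 x)
          · simp [image_eq_zero_of_notMem_tsupport hx]
      _ = b (tsupport f) := lintegral_indicator_one (isClosed_tsupport _).measurableSet
      _ < ⊤ := f.hasCompactSupport.measure_lt_top
  exact ((h f).eventually (lt_mem_nhds (hrK.trans_le hb))).and
    ((h f).eventually (gt_mem_nhds hfin))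

lemma IsULim.le_univ {U : Ultrafilter ℕ} {α : ℕ → Measure X} {b : Measure X}
    (h : IsULim U α b) {K : Set X} (hK : IsCompact K) {t : ℝ≥0∞}
    (ht : ∀ᶠ m in (U : Filter ℕ), t ≤ α m K) : t ≤ b univ := by
  obtain ⟨f, h1, h2, -⟩ := exists_bump hK isOpen_univ (subset_univ K)
  have : t ≤ ∫⁻ x, f x ∂b := by
    refine ge_of_tendsto (h f) (ht.mono fun m hm => hm.trans ?_)
    calc α m K = ∫⁻ x, K.indicator 1 x ∂(α m) := by rw [lintegral_indicator_one hK.measurableSet]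
      _ ≤ _ := lintegral_mono fun x => by by_cases hx : x ∈ K <;> simp [hx, h1 x]
  refine this.trans ?_
  calc ∫⁻ x, f x ∂b ≤ ∫⁻ x, 1 ∂b := lintegral_mono fun x => by exact ENNReal.coe_le_one_iff.2 (h2 x)
    _ = b univ := by simp

lemma IsULim.eq_sum [SigmaCompactSpace X] [SecondCountableTopology X] {U : Ultrafilter ℕ} {α : ℕ → Measure X} {b : Measure X} [b.Regular]
    (h : IsULim U α b) {β : ℕ → ℕ → Measure X} {c : ℕ → Measure X}
    (hβ : ∀ i, IsULim U (β i) (c i))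
    {γ : ℕ → Measure X} {d : Measure X} (hγ : IsULim U γ d)
    (hs : ∀ᶠ m in (U : Filter ℕ), α m = γ m + Measure.sum (fun i => β i m))
    (hloc2 : ∀ K : Set X, IsCompact K → ∃ s : Finset ℕ, 
      ∀ᶠ m in (U : Filter ℕ), ∀ i ∉ s, β i m K = 0) :
    b = d + Measure.sum c := by
  have key : ∀ f : C_c(X, ℝ≥0), ∫⁻ x, f x ∂b = ∫⁻ x, f x ∂(d + Measure.sum c) := by
    intro f
    obtain ⟨s, hsK⟩ := hloc2 _ f.hasCompactSupport
    have hz : ∀ (ν : Measure X), ν (tsupport f) = 0 → ∫⁻ x, f x ∂ν = 0 := by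
      intro ν hν
      refine (lintegral_eq_zero_iff (cc_meas f)).2 ?_
      refine measure_mono_null ?_ hν
      intro x hx
      by_contra hxV
      exact hx (by simp [image_eq_zero_of_notMem_tsupport hxV])
    have hc : ∀ i ∉ s, ∫⁻ x, f x ∂(c i) = 0 := by
      intro i hi
      refine tendsto_nhds_unique (hβ i f) (tendsto_const_nhds.congr' (hsK.mono fun m hm => ?_))
      exact (hz _ (hm i hi)).symm
    rw [lintegral_add_measure, lintegral_sum_measure, tsum_eq_sum hc]
    refine tendsto_nhds_unique (h f) ?_
    refine ((hγ f).add (tendsto_finsetSum s fun i _ => hβ i f)).congr' ?_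
    filter_upwards [hs, hsK] with m hm hm2
    rw [hm, lintegral_add_measure, lintegral_sum_measure, tsum_eq_sum (s := s)]
    intro i hi
    exact hz _ (hm2 i hi)
  have hlf : IsFiniteMeasureOnCompacts (d + Measure.sum c) := by
    refine ⟨fun K hK => ?_⟩
    obtain ⟨f, h1, h2, -⟩ := exists_bump hK isOpen_univ (subset_univ K)
    calc (d + Measure.sum c) K = ∫⁻ x, K.indicator 1 x ∂(d + Measure.sum c) := by
            rw [lintegral_indicator_one hK.measurableSet]
      _ ≤ ∫⁻ x, f x ∂(d + Measure.sum c) := lintegral_mono fun x => by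
            by_cases hx : x ∈ K <;> simp [hx, h1 x]
      _ = ∫⁻ x, f x ∂b := (key f).symm
      _ ≤ ∫⁻ x, (tsupport f).indicator 1 x ∂b := by
          refine lintegral_mono fun x => ?_
          by_cases hx : x ∈ tsupport f
          · simp only [indicator_of_mem hx]; exact ENNReal.coe_le_one_iff.2 (h2 x)
          · simp [image_eq_zero_of_notMem_tsupport hx]
      _ = b (tsupport f) := lintegral_indicator_one (isClosed_tsupport _).measurableSet
      _ < ⊤ := f.hasCompactSupport.measure_lt_top
  have : IsLocallyFiniteMeasure (d + Measure.sum c) := isLocallyFiniteMeasure_of_isFiniteMeasureOnCompacts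
  have : (d + Measure.sum c).Regular := inferInstance
  apply Measure.ext_of_integral_eq_on_compactlySupported_nnreal
  intro f
  have hm : Measurable (fun x => (f x : ℝ)) := (f.continuous.measurable).coe_nnreal_real
  rw [integral_eq_lintegral_of_nonneg_ae (by filter_upwards; simp) hm.aestronglyMeasurable,
    integral_eq_lintegral_of_nonneg_ae (by filter_upwards; simp) hm.aestronglyMeasurable]
  simpa using congrArg ENNReal.toReal (key f)

end RMK

section SplitMeasure
variable {Y : Type*} [MeasurableSpace Y]

lemma split_fin (ρ : Measure Y) (hρ : ρ univ ≠ ⊤) (t : ℕ → ℝ≥0∞) (h : ∑' j, t j ≤ ρ univ) :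
    ∃ (θ : ℕ → Measure Y) (ρ' : Measure Y), (∀ j, θ j univ = t j) ∧
      ρ = Measure.sum θ + ρ' := by
  refine ⟨fun j => (t j / ρ univ) • ρ, (1 - (∑' j, t j) / ρ univ) • ρ, ?_, ?_⟩
  · intro j
    have hj : t j ≤ ρ univ := (ENNReal.le_tsum j).trans h
    simp only [Measure.smul_apply, smul_eq_mul]
    by_cases h0 : ρ univ = 0
    · have : t j = 0 := le_antisymm (h0 ▸ hj) bot_le
      simp [this]
    · exact ENNReal.div_mul_cancel h0 hρ
  · ext B hB
    simp only [Measure.add_apply, Measure.sum_apply _ hB, Measure.smul_apply, smul_eq_mul,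
      ENNReal.tsum_mul_right, div_eq_mul_inv]
    rw [← add_mul, add_tsub_cancel_of_le, one_mul]
    rw [← div_eq_mul_inv]
    exact ENNReal.div_le_of_le_mul (by simpa using h)

lemma split_measure (ρ : Measure Y) (t : ℕ → ℝ≥0∞) (ht : ∀ j, t j ≠ ⊤)
    (h : ∀ r < ∑' j, t j, ∃ η : Measure Y, η ≤ ρ ∧ η univ ≠ ⊤ ∧ r ≤ η univ) :
    ∃ (θ : ℕ → Measure Y) (ρ' : Measure Y), (∀ j, θ j univ = t j) ∧
      ρ = Measure.sum θ + ρ' ∧ (ρ univ = ⊤ → ρ' univ = ⊤) := by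
  by_cases hfin : ρ univ ≠ ⊤
  · have hle : ∑' j, t j ≤ ρ univ := by
      refine le_of_forall_lt fun r hr => ?_
      obtain ⟨r', h1, h2⟩ := exists_between hr
      obtain ⟨η, hη, -, hr'⟩ := h r' h2
      exact h1.trans_le (hr'.trans (hη univ))
    obtain ⟨θ, ρ', h1, h2⟩ := split_fin ρ hfin t hle
    exact ⟨θ, ρ', h1, h2, fun h => absurd h hfin⟩
  push Not at hfin
  by_cases hcase : ∀ C : ℝ≥0∞, C ≠ ⊤ → ∃ A, MeasurableSet A ∧ ρ A ≠ ⊤ ∧ C ≤ ρ A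
  · -- unbounded finite sets
    have step : ∀ (n : ℕ) (B : {B : Set Y // MeasurableSet B ∧ ρ B ≠ ⊤}),
        ∃ B' : {B : Set Y // MeasurableSet B ∧ ρ B ≠ ⊤}, B.1 ⊆ B'.1 ∧
          t n + 1 ≤ ρ (B'.1 \ B.1) := by
      rintro n ⟨B, hB, hBf⟩
      obtain ⟨A, hA, hAf, hCA⟩ := hcase (t n + 1 + ρ B)
        (by simp [ht n, hBf])
      refine ⟨⟨B ∪ A, hB.union hA, ?_⟩, subset_union_left, ?_⟩
      · exact ne_top_of_le_ne_top (by simp [hBf, hAf]) (measure_union_le B A)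
      · have h1 : ρ A ≤ ρ ((B ∪ A) \ B) + ρ B := by
          refine (measure_mono ?_).trans (measure_union_le _ _)
          intro x hx
          by_cases hxB : x ∈ B <;> simp [hx, hxB]
        exact (ENNReal.add_le_add_iff_right hBf).1 (hCA.trans h1)
    choose g hg1 hg2 using step
    let S : ℕ → {B : Set Y // MeasurableSet B ∧ ρ B ≠ ⊤} :=
      fun n => Nat.rec ⟨∅, MeasurableSet.empty, by simp⟩ (fun n B => g n B) n
    have hS : ∀ n, S (n+1) = g n (S n) := fun n => rfl
    let B : ℕ → Set Y := fun n => (S n).1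
    have hBm : ∀ n, MeasurableSet (B n) := fun n => (S n).2.1
    have hmono : Monotone B := monotone_nat_of_le_succ fun n => hg1 n (S n)
    let A : ℕ → Set Y := fun j => disjointed B (j+1)
    have hAeq : ∀ j, A j = B (j+1) \ B j := fun j => hmono.disjointed_add_one j
    have hAm : ∀ j, MeasurableSet (A j) := fun j => by
      rw [hAeq]; exact MeasurableSet.diff (hBm (j+1)) (hBm j)
    have hAd : Pairwise (Function.onFun Disjoint A) := fun i j hij =>
      disjoint_disjointed B (by simpa using hij)
    have hAf : ∀ j, ρ (A j) ≠ ⊤ := fun j => by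
      rw [hAeq]; exact ne_top_of_le_ne_top (S (j+1)).2.2 (measure_mono sdiff_subset)
    have hAt : ∀ j, t j + 1 ≤ ρ (A j) := fun j => by
      rw [hAeq]; exact hg2 j (S j)
    have hA0 : ∀ j, ρ (A j) ≠ 0 := fun j h0 => by
      have := hAt j
      rw [h0] at this
      simp at this
    refine ⟨fun j => (t j / ρ (A j)) • ρ.restrict (A j),
      Measure.sum (fun j => (1 - t j / ρ (A j)) • ρ.restrict (A j)) + ρ.restrict (⋃ j, A j)ᶜ,
      ?_, ?_, ?_⟩
    · intro j
      simp only [Measure.smul_apply, smul_eq_mul, Measure.restrict_apply_univ]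
      exact ENNReal.div_mul_cancel (hA0 j) (hAf j)
    · rw [← add_assoc]
      conv_lhs => rw [← Measure.restrict_add_restrict_compl (μ := ρ) (MeasurableSet.iUnion hAm)]
      congr 1
      rw [Measure.restrict_iUnion hAd hAm]
      ext C hC
      simp only [Measure.add_apply, Measure.sum_apply _ hC, Measure.smul_apply, smul_eq_mul]
      rw [← ENNReal.tsum_add]
      refine tsum_congr fun j => ?_
      rw [← add_mul, add_tsub_cancel_of_le, one_mul]
      refine ENNReal.div_le_of_le_mul ?_
      rw [one_mul]
      exact le_self_add.trans (hAt j)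
    · intro _
      simp only [Measure.add_apply, Measure.sum_apply _ MeasurableSet.univ, Measure.smul_apply,
        smul_eq_mul, Measure.restrict_apply_univ]
      have : ∑' j : ℕ, (1 - t j / ρ (A j)) * ρ (A j) = ⊤ := by
        refine top_le_iff.1 ?_
        rw [← ENNReal.tsum_const_eq_top_of_ne_zero (α := ℕ) (one_ne_zero)]
        refine ENNReal.tsum_le_tsum fun j => ?_
        rw [ENNReal.sub_mul (fun _ _ => hAf j), one_mul, ENNReal.div_mul_cancel (hA0 j) (hAf j)]
        exact ENNReal.le_sub_of_add_le_left (ht j) (hAt j)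
      simp [this]
  · push Not at hcase
    obtain ⟨C, hC, hCA⟩ := hcase
    -- a maximal set of finite measure
    obtain ⟨T, hT, hTf, hTmax⟩ : ∃ T, MeasurableSet T ∧ ρ T ≠ ⊤ ∧
        ∀ A, MeasurableSet A → ρ A ≠ ⊤ → ρ A ≤ ρ T := by
      let R : Set ℝ≥0∞ := {r | ∃ A, MeasurableSet A ∧ ρ A ≠ ⊤ ∧ ρ A = r}
      have hRne : R.Nonempty := ⟨0, ∅, MeasurableSet.empty, by simp, by simp⟩
      obtain ⟨u, -, hu, huR⟩ := exists_seq_tendsto_sSup hRne (OrderTop.bddAbove R)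
      choose A hAm hAf hAu using huR
      have hacc : ∀ n, MeasurableSet (accumulate A n) ∧ ρ (accumulate A n) ≠ ⊤ := by
        intro n
        induction n with
        | zero => simpa using ⟨hAm 0, hAf 0⟩
        | succ n ih =>
          rw [accumulate_succ]
          exact ⟨ih.1.union (hAm _), ne_top_of_le_ne_top (by simp [ih.2, hAf]) (measure_union_le _ _)⟩
      have hle : ρ (⋃ n, A n) ≤ C := by
        rw [measure_iUnion_eq_iSup_accumulate]
        exact iSup_le fun n => (hCA _ (hacc n).1 (hacc n).2).le
      refine ⟨⋃ n, A n, MeasurableSet.iUnion hAm, ne_top_of_le_ne_top hC hle, ?_⟩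
      intro B hB hBf
      refine (le_sSup (show ρ B ∈ R from ⟨B, hB, hBf, rfl⟩)).trans ?_
      exact le_of_tendsto hu (Eventually.of_forall fun n => hAu n ▸ measure_mono (subset_iUnion A n))
    have hpure : ∀ B, MeasurableSet B → B ⊆ Tᶜ → ρ B ≠ ⊤ → ρ B = 0 := by
      intro B hB hBT hBf
      have h1 := hTmax (T ∪ B) (hT.union hB)
        (ne_top_of_le_ne_top (by simp [hTf, hBf]) (measure_union_le _ _))
      rw [measure_union (disjoint_left.2 fun x hx hx2 => hBT hx2 hx) hB] at h1
      by_contra h0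
      exact absurd h1 (not_le.2 (ENNReal.lt_add_right hTf h0))
    have hTc : ρ Tᶜ = ⊤ := by
      have := measure_add_measure_compl (μ := ρ) hT
      rw [hfin] at this
      by_contra h0
      exact absurd this (by simp [hTf, h0])
    by_cases hsub : ∃ η : Measure Y, η ≤ ρ.restrict Tᶜ ∧ η univ ≠ ⊤ ∧ η univ ≠ 0
    · obtain ⟨η, hη, hηf, hη0⟩ := hsub
      refine ⟨fun j => (t j / η univ) • η, ρ, ?_, ?_, fun h => h⟩
      · intro j
        simp only [Measure.smul_apply, smul_eq_mul]
        exact ENNReal.div_mul_cancel hη0 hηf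
      · ext B hB
        simp only [Measure.add_apply, Measure.sum_apply _ hB, Measure.smul_apply, smul_eq_mul]
        by_cases h0 : η B = 0
        · simp [h0]
        · have h1 : ρ B = ⊤ := by
            have h2 : ρ (B ∩ Tᶜ) ≠ 0 := by
              intro h3
              have := hη B
              rw [Measure.restrict_apply hB, h3] at this
              exact h0 (le_antisymm this bot_le)
            have h3 : ρ (B ∩ Tᶜ) = ⊤ := by
              by_contra h4
              exact h2 (hpure _ (hB.inter hT.compl) inter_subset_right h4)
            exact top_le_iff.1 (h3 ▸ measure_mono inter_subset_left)
          simp [h1]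
    · push Not at hsub
      have hle : ∑' j, t j ≤ ρ.restrict T univ := by
        rw [Measure.restrict_apply_univ]
        refine le_of_forall_lt fun r hr => ?_
        obtain ⟨r', h1, h2⟩ := exists_between hr
        obtain ⟨η, hη, hηf, hr'⟩ := h r' h2
        have h3 := hsub (η.restrict Tᶜ) (Measure.restrict_mono subset_rfl hη)
          (by rw [Measure.restrict_apply_univ]; exact ne_top_of_le_ne_top hηf (measure_mono (subset_univ _)))
        rw [Measure.restrict_apply_univ] at h3
        have h4 := measure_add_measure_compl (μ := η) hT
        rw [h3, add_zero] at h4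
        exact h1.trans_le (hr'.trans (h4 ▸ hη T))
      obtain ⟨θ, ρ', h1, h2⟩ := split_fin (ρ.restrict T) (by simpa using hTf) t hle
      refine ⟨θ, ρ' + ρ.restrict Tᶜ, h1, ?_, ?_⟩
      · rw [← add_assoc, ← h2, Measure.restrict_add_restrict_compl hT]
      · intro _
        simp [hTc]

end SplitMeasure

section Geometry

lemma pt_cont (i : Fin 2) : Continuous fun x : Pt => x i := by fun_prop

lemma uhp_open : IsOpen UHP := isOpen_lt (pt_cont 0) (pt_cont 1)
lemma diag_closed : IsClosed Diag := isClosed_eq (pt_cont 0) (pt_cont 1)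
lemma uhpbar_eq : UHPbar = {x : Pt | x 0 ≤ x 1} := by
  ext x; simp only [UHPbar, UHP, Diag, mem_union, mem_ofPred_eq]; exact le_iff_lt_or_eq.symm
lemma uhpbar_closed : IsClosed UHPbar := by
  rw [uhpbar_eq]; exact isClosed_le (pt_cont 0) (pt_cont 1)
lemma uhp_sub : UHP ⊆ UHPbar := subset_union_left
lemma diag_ne : Diag.Nonempty := ⟨0, by simp [Diag]⟩
lemma pers_cont : Continuous persDist := continuous_infDist_pt _
lemma pers_nonneg (x : Pt) : 0 ≤ persDist x := infDist_nonneg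
lemma pers_le (x y : Pt) : persDist x ≤ persDist y + dist x y := infDist_le_infDist_add_dist
lemma pers_pos {x : Pt} (hx : x ∈ UHP) : 0 < persDist x := by
  refine (diag_closed.notMem_iff_infDist_pos diag_ne).1 ?_
  simp only [UHP, Diag, mem_ofPred_eq] at *
  exact hx.ne
lemma mem_uhp {x : Pt} (hx : x ∈ UHPbar) (h : 0 < persDist x) : x ∈ UHP := by
  rcases hx with hx | hx
  · exact hx
  · rw [persDist, infDist_zero_of_mem hx] at h; exact absurd h (lt_irrefl _)

def prj (x : Pt) : Pt := mk2 ((x 0 + x 1) / 2) ((x 0 + x 1) / 2)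

lemma prj_mem (x : Pt) : prj x ∈ Diag := by simp [prj, Diag, mk2]
lemma prj_cont : Continuous prj := by
  unfold prj mk2
  have : Continuous fun x : Pt => (![(x 0 + x 1) / 2, (x 0 + x 1) / 2] : Fin 2 → ℝ) := by
    refine continuous_pi fun i => ?_
    fin_cases i <;> simp <;> fun_prop
  exact (PiLp.continuous_toLp 2 _).comp this
lemma prj_dist (x : Pt) : dist x (prj x) ≤ persDist x := by
  refine (le_infDist diag_ne).2 fun y hy => ?_
  simp only [Diag, mem_ofPred_eq] at hy
  rw [EuclideanSpace.dist_eq, EuclideanSpace.dist_eq]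
  apply Real.sqrt_le_sqrt
  simp only [Fin.sum_univ_two, prj, mk2, Real.dist_eq, sq_abs]
  simp only [WithLp.equiv_symm_apply, Matrix.cons_val_zero, Matrix.cons_val_one]
  rw [← hy]
  nlinarith [sq_nonneg (x 0 + x 1 - 2 * y 0)]

end Geometry

section Costs

lemma costInf_le {π : Measure (Pt × Pt)} {c : ℝ} (h : π {z | c < dist z.1 z.2} = 0) :
    CostInf π ≤ ENNReal.ofReal c := by
  refine iSup₂_le fun z hz => ?_
  refine ENNReal.ofReal_le_ofReal ?_
  by_contra! hc
  refine hz _ (IsOpen.mem_nhds ?_ hc) h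
  exact isOpen_lt continuous_const (continuous_fst.dist continuous_snd)

lemma null_of_costInf {π : Measure (Pt × Pt)} {c : ℝ} (hc : 0 ≤ c)
    (h : CostInf π ≤ ENNReal.ofReal c) :
    π {z | c < dist z.1 z.2} = 0 := by
  refine measure_null_of_locally_null _ fun z hz => ?_
  by_cases hm : z ∈ msupp π
  · have := (le_iSup₂ (f := fun z (_ : z ∈ msupp π) => ENNReal.ofReal (dist z.1 z.2)) z hm).trans h
    rw [ENNReal.ofReal_le_ofReal_iff hc] at this
    exact absurd hz (not_lt.2 this)
  · simp only [msupp, mem_ofPred_eq, not_forall, not_not] at hm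
    obtain ⟨V, hV, h0⟩ := hm
    exact ⟨V, mem_nhdsWithin_of_mem_nhds hV, h0⟩

lemma exists_plan {μ ν : Measure Pt} {ε ε' : ℝ} (h0 : 0 ≤ ε) (hε : ε < ε')
    (h : OTinfE μ ν ≤ ENNReal.ofReal ε) :
    ∃ π ∈ Adm μ ν, π {z | ε' < dist z.1 z.2} = 0 := by
  have : OTinfE μ ν < ENNReal.ofReal ε' := h.trans_lt (by
    rw [ENNReal.ofReal_lt_ofReal_iff] <;> linarith)
  simp only [OTinfE, iInf_lt_iff] at this
  obtain ⟨π, hπ, hc⟩ := this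
  exact ⟨π, hπ, null_of_costInf (h0.trans hε.le) hc.le⟩

lemma pers_null_of_mem {μ : Measure Pt} (h : MemMinf μ) :
    ∃ C : ℝ, 0 ≤ C ∧ μ {x | C < persDist x} = 0 := by
  obtain ⟨C, hC⟩ := h.2
  refine ⟨max C 0, le_max_right _ _, ?_⟩
  refine measure_null_of_locally_null _ fun z hz => ?_
  by_cases hm : z ∈ suppM μ
  · exact absurd hz (not_lt.2 ((hC z hm).trans (le_max_left _ _)))
  · simp only [suppM, mem_ofPred_eq, not_forall, not_not] at hm
    obtain ⟨V, hV, h0⟩ := hm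
    exact ⟨V, mem_nhdsWithin_of_mem_nhds hV, h0⟩

lemma mem_of_pers_null {μ : Measure Pt} (h0 : μ UHPᶜ = 0) {C : ℝ}
    (h : μ {x | C < persDist x} = 0) : MemMinf μ := by
  refine ⟨h0, C, fun x hx => ?_⟩
  by_contra! hc
  exact hx _ ((isOpen_lt continuous_const pers_cont).mem_nhds hc) h

/-- transfer -/
lemma plan_le {μ ν : Measure Pt} {π : Measure (Pt × Pt)} {ε : ℝ} (hπ : π ∈ Adm μ ν)
    (hd : π {z | ε < dist z.1 z.2} = 0) {A B : Set Pt} (hA : MeasurableSet A) (hAU : A ⊆ UHP)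
    (hB : MeasurableSet B) (hBU : B ⊆ UHP)
    (h : ∀ x ∈ A, ∀ y ∈ UHPbar, dist x y ≤ ε → y ∈ B) : μ A ≤ ν B := by
  rw [← hπ.2.1 A hA hAU, ← hπ.2.2 B hB hBU]
  have : π (A ×ˢ univ) ≤ π (univ ×ˢ B ∪ ({z | ε < dist z.1 z.2} ∪ (UHPbar ×ˢ UHPbar)ᶜ)) := by
    refine measure_mono fun z hz => ?_
    by_cases h1 : ε < dist z.1 z.2
    · exact Or.inr (Or.inl h1)
    by_cases h2 : z ∈ UHPbar ×ˢ UHPbar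
    · exact Or.inl ⟨mem_univ _, h _ hz.1 _ h2.2 (not_lt.1 h1)⟩
    · exact Or.inr (Or.inr h2)
  refine this.trans ((measure_union_le _ _).trans ?_)
  rw [measure_union_null hd hπ.1, add_zero]

lemma plan_le' {μ ν : Measure Pt} {π : Measure (Pt × Pt)} {ε : ℝ} (hπ : π ∈ Adm μ ν)
    (hd : π {z | ε < dist z.1 z.2} = 0) {A B : Set Pt} (hA : MeasurableSet A) (hAU : A ⊆ UHP)
    (hB : MeasurableSet B) (hBU : B ⊆ UHP)
    (h : ∀ y ∈ B, ∀ x ∈ UHPbar, dist x y ≤ ε → x ∈ A) : ν B ≤ μ A := by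
  rw [← hπ.2.1 A hA hAU, ← hπ.2.2 B hB hBU]
  have : π (univ ×ˢ B) ≤ π (A ×ˢ univ ∪ ({z | ε < dist z.1 z.2} ∪ (UHPbar ×ˢ UHPbar)ᶜ)) := by
    refine measure_mono fun z hz => ?_
    by_cases h1 : ε < dist z.1 z.2
    · exact Or.inr (Or.inl h1)
    by_cases h2 : z ∈ UHPbar ×ˢ UHPbar
    · exact Or.inl ⟨h _ hz.2 _ h2.1 (not_lt.1 h1), mem_univ _⟩
    · exact Or.inr (Or.inr h2)
  refine this.trans ((measure_union_le _ _).trans ?_)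
  rw [measure_union_null hd hπ.1, add_zero]

end Costs

section Cell
variable {Y : Type*} [MeasurableSpace Y]

lemma map_fst_prod_aux (ρ β : Measure Y) [SFinite β] :
    (ρ.prod β).map Prod.fst = β univ • ρ := by
  ext A hA
  rw [Measure.map_apply measurable_fst hA, ← prod_univ, Measure.prod_prod]
  simp [mul_comm]

lemma map_snd_prod_aux (ρ β : Measure Y) [SFinite β] :
    (ρ.prod β).map Prod.snd = ρ univ • β := by
  ext A hA
  rw [Measure.map_apply measurable_snd hA, ← univ_prod, Measure.prod_prod]
  simp

lemma cell_plan (ρ β w : Measure Y) [SFinite β] [IsFiniteMeasure w]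
    (h3 : ∀ r < β univ, ∃ η : Measure Y, η ≤ ρ ∧ η univ ≠ ⊤ ∧ r ≤ η univ)
    (h4 : w univ = 0 → ρ univ ≤ β univ ∧ ρ univ ≠ ⊤) :
    ∃ (P : Measure (Y × Y)) (κ : ℝ≥0∞), P.map Prod.fst = ρ ∧ P.map Prod.snd = β + κ • w ∧
      (ρ univ = ⊤ → κ = ⊤) := by
  let bj := sfiniteSeq β
  let t : ℕ → ℝ≥0∞ := fun j => bj j univ
  have ht : ∀ j, t j ≠ ⊤ := fun j => measure_ne_top _ _
  have hb : Measure.sum bj = β := sum_sfiniteSeq β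
  have hsum : ∑' j, t j = β univ := by
    rw [← hb, Measure.sum_apply _ MeasurableSet.univ]
  obtain ⟨θ, ρ', hθ, hρ, hinf⟩ := split_measure ρ t ht (by rw [hsum]; exact h3)
  have hw0 : w univ = 0 → ρ' = 0 := by
    intro h0
    obtain ⟨h5, h6⟩ := h4 h0
    have h7 : ρ univ = β univ + ρ' univ := by
      conv_lhs => rw [hρ]
      rw [Measure.add_apply, Measure.sum_apply _ MeasurableSet.univ]
      simp only [hθ, hsum]
    have h8 : β univ ≠ ⊤ := fun h => h6 (by rw [h7, h]; simp)
    have h9 : β univ + ρ' univ ≤ β univ + 0 := by rw [← h7, add_zero]; exact h5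
    have := (ENNReal.add_le_add_iff_left h8).1 h9
    exact Measure.measure_univ_eq_zero.1 (le_antisymm this (zero_le))
  have hwt : w univ ≠ ⊤ := measure_ne_top _ _
  refine ⟨Measure.sum (fun j => (t j)⁻¹ • (θ j).prod (bj j)) + (w univ)⁻¹ • ρ'.prod w,
    ρ' univ * (w univ)⁻¹, ?_, ?_, ?_⟩
  · rw [Measure.map_add _ _ measurable_fst, Measure.map_sum measurable_fst.aemeasurable]
    conv_rhs => rw [hρ]
    congr 1
    · congr 1
      ext1 j
      rw [Measure.map_smul, map_fst_prod_aux, smul_smul]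
      by_cases h0 : t j = 0
      · have : θ j = 0 := Measure.measure_univ_eq_zero.1 ((hθ j).trans h0)
        simp [this]
      · rw [ENNReal.inv_mul_cancel h0 (ht j), one_smul]
    · rw [Measure.map_smul, map_fst_prod_aux, smul_smul]
      by_cases h0 : w univ = 0
      · simp [hw0 h0]
      · rw [ENNReal.inv_mul_cancel h0 hwt, one_smul]
  · rw [Measure.map_add _ _ measurable_snd, Measure.map_sum measurable_snd.aemeasurable]
    congr 1
    · rw [← hb]
      congr 1
      ext1 j
      rw [Measure.map_smul, map_snd_prod_aux, smul_smul, hθ]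
      by_cases h0 : t j = 0
      · have : bj j = 0 := Measure.measure_univ_eq_zero.1 h0
        simp [this]
      · rw [ENNReal.inv_mul_cancel h0 (ht j), one_smul]
    · rw [Measure.map_smul, map_snd_prod_aux, smul_smul, mul_comm]
  · intro h
    rw [hinf h, ENNReal.top_mul]
    simpa using hwt

end Cell

section Glue

lemma null_fst {P : Measure (Pt × Pt)} {ρ : Measure Pt} (h : P.map Prod.fst = ρ) {A : Set Pt}
    (hA : MeasurableSet A) (h0 : ρ A = 0) : P (Prod.fst ⁻¹' A) = 0 := by
  rw [← h, Measure.map_apply measurable_fst hA] at h0; exact h0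

lemma null_snd {P : Measure (Pt × Pt)} {ρ : Measure Pt} (h : P.map Prod.snd = ρ) {A : Set Pt}
    (hA : MeasurableSet A) (h0 : ρ A = 0) : P (Prod.snd ⁻¹' A) = 0 := by
  rw [← h, Measure.map_apply measurable_snd hA] at h0; exact h0

lemma uhp_disj {x : Pt} (h : x ∈ UHP) (h' : x ∈ Diag) : False := by
  exact (ne_of_lt h) h'

lemma glue (ρ0 : Measure Pt) {ε : ℝ} (hε : 0 < ε) (c : ℕ → Pt) (Q : ℕ → Set Pt)
    (hQm : ∀ i, MeasurableSet (Q i)) (hQd : Pairwise (Function.onFun Disjoint Q))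
    (hQb : ∀ i, Q i ⊆ ball (c i) ε) (hQU : ⋃ i, Q i = UHP ∩ {x | 2 * ε < persDist x})
    (β : ℕ → Measure Pt) [∀ i, SFinite (β i)] (βR : Measure Pt) (w : Measure Pt)
    [IsFiniteMeasure w] (F : Set Pt)
    (hβ1 : ∀ i, β i {y | 2 * ε < dist y (c i)} = 0) (hβU : ∀ i, β i UHPᶜ = 0)
    (hβR : βR {y | 3 * ε < persDist y} = 0) (hβRU : βR UHPᶜ = 0)
    (hwU : w UHPᶜ = 0) (hwF : w Fᶜ = 0)
    (h3 : ∀ i, ∀ r < β i univ, ∃ η : Measure Pt, η ≤ ρ0.restrict (Q i) ∧ η univ ≠ ⊤ ∧ r ≤ η univ)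
    (h4 : ∀ i, w (ball (c i) (3 * ε)) = 0 → ρ0 (Q i) ≤ β i univ ∧ ρ0 (Q i) ≠ ⊤)
    (h6 : ∀ z ∈ F, 5 * ε < persDist z → ∃ i, ρ0 (Q i) = ⊤ ∧ dist z (c i) < 3 * ε) :
    ∃ P ∈ Adm ρ0 (βR + Measure.sum β + (⊤ : ℝ≥0∞) • w), P {z | 8 * ε < dist z.1 z.2} = 0 := by
  have hcell := fun i => cell_plan (ρ0.restrict (Q i)) (β i) (w.restrict (ball (c i) (3 * ε)))
    (h3 i) (by
      intro h
      simp only [Measure.restrict_apply_univ] at *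
      exact h4 i h)
  choose P κ hP1 hP2 hκ using hcell
  have hUm : MeasurableSet UHP := uhp_open.measurableSet
  have hDm : MeasurableSet Diag := diag_closed.measurableSet
  have hBm : MeasurableSet UHPbar := uhpbar_closed.measurableSet
  have hpm : Measurable persDist := pers_cont.measurable
  let N2 : Set Pt := UHP ∩ {x | persDist x ≤ 2 * ε}
  have hN2 : MeasurableSet N2 := hUm.inter (measurableSet_le hpm measurable_const)
  let N5 : Set Pt := {x | persDist x ≤ 5 * ε}
  have hN5 : MeasurableSet N5 := measurableSet_le hpm measurable_const
  let f : Pt → Pt × Pt := fun x => (x, prj x)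
  let g : Pt → Pt × Pt := fun x => (prj x, x)
  have hf : Measurable f := measurable_id.prodMk prj_cont.measurable
  have hg : Measurable g := prj_cont.measurable.prodMk measurable_id
  let σ : Measure Pt := βR + (⊤ : ℝ≥0∞) • w.restrict N5
  have hσU : σ UHPᶜ = 0 := by
    simp only [σ, Measure.add_apply, Measure.smul_apply, hβRU, Measure.restrict_apply hUm.compl]
    rw [measure_mono_null inter_subset_left hwU]; simp
  have hσ5 : σ {y | 5 * ε < persDist y} = 0 := by
    have hm : MeasurableSet {y | 5 * ε < persDist y} := measurableSet_lt measurable_const hpm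
    simp only [σ, Measure.add_apply, Measure.smul_apply, Measure.restrict_apply hm]
    rw [measure_mono_null (s := {y | 5 * ε < persDist y}) (fun y (hy : 5 * ε < persDist y) => (by
      show 3 * ε < persDist y
      linarith)) hβR]
    have : {y | 5 * ε < persDist y} ∩ N5 = ∅ := by
      ext y
      simp only [N5, mem_inter_iff, mem_ofPred_eq, mem_empty_iff_false, iff_false, not_and, not_le]
      exact id
    simp [this]
  have hdm : MeasurableSet {z : Pt × Pt | 8 * ε < dist z.1 z.2} :=
    (isOpen_lt continuous_const (continuous_fst.dist continuous_snd)).measurableSet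
  refine ⟨Measure.sum P + (ρ0.restrict N2).map f + σ.map g, ⟨?_, ?_, ?_⟩, ?_⟩
  · have hm : MeasurableSet ((UHPbar ×ˢ UHPbar : Set (Pt × Pt))ᶜ) := (hBm.prod hBm).compl
    rw [Measure.add_apply, Measure.add_apply, Measure.sum_apply _ hm, Measure.map_apply hf hm,
      Measure.map_apply hg hm]
    have e1 : ∀ i, P i ((UHPbar ×ˢ UHPbar : Set (Pt × Pt))ᶜ) = 0 := by
      intro i
      have a1 := null_fst (hP1 i) (hQm i).compl (by simp [Measure.restrict_apply (hQm i).compl])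
      have a2 := null_snd (hP2 i) hUm.compl (by
        simp only [Measure.add_apply, Measure.smul_apply, hβU, Measure.restrict_apply hUm.compl]
        rw [measure_mono_null inter_subset_left hwU]; simp)
      refine measure_mono_null ?_ (measure_union_null a1 a2)
      intro z hz
      by_contra hcon
      simp only [mem_union, mem_preimage, mem_compl_iff, not_or, not_not] at hcon
      have : z.1 ∈ ⋃ i, Q i := mem_iUnion.2 ⟨i, hcon.1⟩
      rw [hQU] at this
      exact hz ⟨uhp_sub this.1, uhp_sub hcon.2⟩
    have e2 : ρ0.restrict N2 (f ⁻¹' (UHPbar ×ˢ UHPbar)ᶜ) = 0 := by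
      rw [Measure.restrict_apply (hf hm)]
      convert measure_empty (μ := ρ0)
      ext x
      simp only [mem_inter_iff, mem_preimage, mem_compl_iff, mem_empty_iff_false, iff_false, not_and]
      intro h1 h2
      exact h1 ⟨uhp_sub h2.1, Or.inr (prj_mem x)⟩
    have e3 : σ (g ⁻¹' (UHPbar ×ˢ UHPbar)ᶜ) = 0 := by
      refine measure_mono_null ?_ hσU
      intro x hx hx2
      exact hx ⟨Or.inr (prj_mem x), uhp_sub hx2⟩
    rw [e2, e3]; simp [e1]
  · intro A hA hAU
    have hm : MeasurableSet (A ×ˢ (univ : Set Pt)) := hA.prod MeasurableSet.univ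
    rw [Measure.add_apply, Measure.add_apply, Measure.sum_apply _ hm, Measure.map_apply hf hm,
      Measure.map_apply hg hm]
    have e1 : ∀ i, P i (A ×ˢ univ) = ρ0 (A ∩ Q i) := by
      intro i
      rw [← Measure.restrict_apply hA, ← hP1 i, Measure.map_apply measurable_fst hA, prod_univ]
    have e2 : ρ0.restrict N2 (f ⁻¹' (A ×ˢ univ)) = ρ0 (A ∩ N2) := by
      have : f ⁻¹' (A ×ˢ univ) = A := by ext x; simp [f]
      rw [this, Measure.restrict_apply hA]
    have e3 : g ⁻¹' (A ×ˢ univ) = ∅ := by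
      ext x
      simp only [mem_preimage, mem_prod, mem_univ, and_true, mem_empty_iff_false, iff_false, g]
      intro h
      exact uhp_disj (hAU h) (prj_mem x)
    rw [e2, e3]
    simp only [e1, measure_empty, add_zero]
    rw [← measure_iUnion (fun i j hij => ((hQd hij).mono inter_subset_right inter_subset_right))
      (fun i => hA.inter (hQm i)), ← inter_iUnion, hQU, ← measure_union _ (hA.inter hN2)]
    · congr 1
      ext x
      simp only [N2, mem_union, mem_inter_iff, mem_ofPred_eq]
      constructor
      · rintro (h | h) <;> exact h.1
      · intro h
        rcases lt_or_ge (2 * ε) (persDist x) with h1 | h1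
        · exact Or.inl ⟨h, hAU h, h1⟩
        · exact Or.inr ⟨h, hAU h, h1⟩
    · refine Set.disjoint_left.2 fun x hx hx' => ?_
      have q1 : persDist x ≤ 2 * ε := hx'.2.2
      have q2 : 2 * ε < persDist x := hx.2.2
      linarith
  · intro B hB hBU
    have hm : MeasurableSet ((univ : Set Pt) ×ˢ B) := MeasurableSet.univ.prod hB
    rw [Measure.add_apply, Measure.add_apply, Measure.sum_apply _ hm, Measure.map_apply hf hm,
      Measure.map_apply hg hm]
    have e1 : ∀ i, P i (univ ×ˢ B) = β i B + κ i * w (B ∩ ball (c i) (3 * ε)) := by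
      intro i
      rw [univ_prod, ← Measure.map_apply measurable_snd hB, hP2]
      simp [Measure.restrict_apply hB]
    have e2 : f ⁻¹' (univ ×ˢ B) = ∅ := by
      ext x
      simp only [mem_preimage, mem_prod, mem_univ, true_and, mem_empty_iff_false, iff_false, f]
      intro h
      exact uhp_disj (hBU h) (prj_mem x)
    have e3 : g ⁻¹' (univ ×ˢ B) = B := by ext x; simp [g]
    rw [e2, e3]
    simp only [e1, measure_empty, add_zero, σ, Measure.add_apply, Measure.smul_apply, smul_eq_mul,
      Measure.sum_apply _ hB, Measure.restrict_apply hB]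
    rw [ENNReal.tsum_add]
    have key : ∑' i, κ i * w (B ∩ ball (c i) (3 * ε)) + ⊤ * w (B ∩ N5) = ⊤ * w B := by
      by_cases hwB : w B = 0
      · have h1 : ∀ S, w (B ∩ S) = 0 := fun S => measure_mono_null inter_subset_left hwB
        simp [h1, hwB]
      rw [ENNReal.top_mul hwB]
      by_cases hw5 : w (B ∩ N5) = 0
      · have : ∃ i, κ i = ⊤ ∧ w (B ∩ ball (c i) (3 * ε)) ≠ 0 := by
          by_contra! hcon
          apply hwB
          have hU : w (⋃ i, ⋃ (_ : κ i = ⊤), B ∩ ball (c i) (3 * ε)) = 0 :=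
            measure_iUnion_null fun i => measure_iUnion_null fun hi => hcon i hi
          refine measure_mono_null ?_ (measure_union_null (measure_union_null hw5 hwF) hU)
          intro z hz
          by_cases hz5 : z ∈ N5
          · exact Or.inl (Or.inl ⟨hz, hz5⟩)
          by_cases hzF : z ∈ F
          · obtain ⟨i, hi, hd⟩ := h6 z hzF (not_le.1 hz5)
            exact Or.inr (mem_iUnion₂.2 ⟨i, hκ i (by simpa using hi), hz, hd⟩)
          · exact Or.inl (Or.inr hzF)
        obtain ⟨i, hi, hne⟩ := this
        have : ∑' i, κ i * w (B ∩ ball (c i) (3 * ε)) = ⊤ := by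
          refine ENNReal.tsum_eq_top_of_eq_top ⟨i, ?_⟩
          rw [hi, ENNReal.top_mul hne]
        rw [this, top_add]
      · rw [ENNReal.top_mul hw5, add_top]
    rw [← key]
    ring
  · rw [Measure.add_apply, Measure.add_apply, Measure.sum_apply _ hdm, Measure.map_apply hf hdm,
      Measure.map_apply hg hdm]
    have e1 : ∀ i, P i {z | 8 * ε < dist z.1 z.2} = 0 := by
      intro i
      have a1 := null_fst (hP1 i) (hQm i).compl (by simp [Measure.restrict_apply (hQm i).compl])
      have hm3 : MeasurableSet {y | 3 * ε ≤ dist y (c i)} :=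
        (isClosed_le continuous_const (continuous_id.dist continuous_const)).measurableSet
      have a2 := null_snd (hP2 i) hm3 (by
        simp only [Measure.add_apply, Measure.smul_apply, Measure.restrict_apply hm3]
        rw [measure_mono_null (s := {y | 3 * ε ≤ dist y (c i)}) (fun y (hy : 3 * ε ≤ dist y (c i)) => (by
          show 2 * ε < dist y (c i)
          linarith)) (hβ1 i)]
        have : {y | 3 * ε ≤ dist y (c i)} ∩ ball (c i) (3 * ε) = ∅ := by
          ext y
          simp only [mem_inter_iff, mem_ofPred_eq, mem_ball, mem_empty_iff_false, iff_false, not_and,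
            not_lt]
          exact id
        simp [this])
      refine measure_mono_null ?_ (measure_union_null a1 a2)
      intro z hz
      by_contra hcon
      simp only [mem_union, mem_preimage, mem_compl_iff, not_or, not_not, mem_ofPred_eq,
        not_le] at hcon
      have h1 : dist z.1 (c i) < ε := hQb i hcon.1
      have h2 := dist_triangle_right z.1 z.2 (c i)
      have hz' : 8 * ε < dist z.1 z.2 := hz
      linarith [hcon.2]
    have e2 : ρ0.restrict N2 (f ⁻¹' {z | 8 * ε < dist z.1 z.2}) = 0 := by
      rw [Measure.restrict_apply (hf hdm)]
      convert measure_empty (μ := ρ0)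
      ext x
      simp only [mem_inter_iff, mem_preimage, mem_empty_iff_false, iff_false, not_and]
      intro h1 h2
      have h3 : persDist x ≤ 2 * ε := h2.2
      have h4 : 8 * ε < dist x (prj x) := h1
      linarith [prj_dist x]
    have e3 : σ (g ⁻¹' {z | 8 * ε < dist z.1 z.2}) = 0 := by
      refine measure_mono_null ?_ hσ5
      intro x hx
      have h4 : 8 * ε < dist (prj x) x := hx
      show 5 * ε < persDist x
      rw [dist_comm] at h4
      linarith [prj_dist x]
    rw [e2, e3]; simp [e1]

end Glue

section Cells

def cc (i : ℕ) : Pt := TopologicalSpace.denseSeq Pt i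

def Far (ε : ℝ) : Set Pt := UHP ∩ {x | 2 * ε < persDist x}

def Qc (ε : ℝ) (i : ℕ) : Set Pt := disjointed (fun i => ball (cc i) ε) i ∩ Far ε

lemma far_meas (ε : ℝ) : MeasurableSet (Far ε) :=
  uhp_open.measurableSet.inter (measurableSet_lt measurable_const pers_cont.measurable)

lemma qc_meas (ε : ℝ) (i : ℕ) : MeasurableSet (Qc ε i) :=
  (MeasurableSet.disjointed (fun _ => measurableSet_ball) i).inter (far_meas ε)

lemma qc_disj (ε : ℝ) : Pairwise (Function.onFun Disjoint (Qc ε)) := fun i j hij =>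
  (disjoint_disjointed (fun i => ball (cc i) ε) hij).mono inter_subset_left inter_subset_left

lemma qc_ball (ε : ℝ) (i : ℕ) : Qc ε i ⊆ ball (cc i) ε :=
  inter_subset_left.trans (disjointed_subset (fun i => ball (cc i) ε) i)

lemma ball_cover {ε : ℝ} (hε : 0 < ε) : ⋃ i, ball (cc i) ε = univ := by
  refine eq_univ_of_forall fun x => ?_
  obtain ⟨i, hi⟩ := (TopologicalSpace.denseRange_denseSeq Pt).exists_dist_lt x hε
  exact mem_iUnion.2 ⟨i, hi⟩

lemma qc_union {ε : ℝ} (hε : 0 < ε) : ⋃ i, Qc ε i = Far ε := by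
  unfold Qc
  rw [← iUnion_inter, iUnion_disjointed, ball_cover hε, univ_inter]

lemma qc_finite {ε : ℝ} (hε : 0 < ε) {K : Set Pt} (hK : IsCompact K) :
    ∃ s : Finset ℕ, ∀ i, ∀ x ∈ Qc ε i, x ∈ K → i ∈ s := by
  obtain ⟨t, ht⟩ := hK.elim_finite_subcover (fun i => ball (cc i) ε) (fun i => isOpen_ball)
    (by rw [ball_cover hε]; exact subset_univ _)
  refine ⟨Finset.range (t.sup id + 1), fun i x hx hxK => ?_⟩
  obtain ⟨j, hj, hxj⟩ := mem_iUnion₂.1 (ht hxK)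
  rw [Finset.mem_range]
  have hjs : j ≤ t.sup id := Finset.le_sup (f := id) hj
  by_contra hcon
  have hji : j < i := by omega
  have hx1 := hx.1
  rw [disjointed_apply] at hx1
  apply hx1.2
  simp only [Finset.sup_eq_iSup, iSup_eq_iUnion, mem_iUnion]
  exact ⟨j, Finset.mem_Iio.2 hji, hxj⟩

end Cells

section Tau
open scoped NNReal CompactlySupported

/-- The part of the second marginal coming from `S`, on the open set `V`. -/
def tau (V : Set Pt) (p : Measure (Pt × Pt)) (S : Set Pt) : Measure V :=
  ((p.restrict (S ×ˢ univ)).map Prod.snd).comap Subtype.val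

variable {V : Set Pt} {p : Measure (Pt × Pt)} {S : Set Pt}

lemma tau_apply (hV : MeasurableSet V) (p : Measure (Pt × Pt)) (S : Set Pt) {E : Set V}
    (hE : MeasurableSet E) : tau V p S E = p (S ×ˢ (Subtype.val '' E)) := by
  have hEm : MeasurableSet (Subtype.val '' E) := hV.subtype_image hE
  rw [tau, (MeasurableEmbedding.subtype_coe hV).comap_apply, Measure.map_apply measurable_snd hEm,
    Measure.restrict_apply (measurable_snd hEm)]
  congr 1
  ext z
  simp only [mem_inter_iff, mem_preimage, mem_prod, mem_univ, and_true]
  exact and_comm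

lemma tau_le (hV : MeasurableSet V) (hVU : V ⊆ UHP) {μ ν : Measure Pt} (hp : p ∈ Adm μ ν)
    (S : Set Pt) : tau V p S ≤ ν.comap Subtype.val := by
  refine Measure.le_iff.2 fun E hE => ?_
  have hEm : MeasurableSet (Subtype.val '' E) := hV.subtype_image hE
  rw [tau_apply hV p S hE, (MeasurableEmbedding.subtype_coe hV).comap_apply,
    ← hp.2.2 _ hEm ((Subtype.coe_image_subset V E).trans hVU)]
  exact measure_mono (prod_mono_left (subset_univ _))

lemma tau_sum (hV : MeasurableSet V) (hVU : V ⊆ UHP) {μ ν : Measure Pt} (hp : p ∈ Adm μ ν)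
    {ε : ℝ} (hε : 0 < ε) : ν.comap Subtype.val = tau V p (Far ε)ᶜ +
      Measure.sum (fun i => tau V p (Qc ε i)) := by
  ext E hE
  have hEm : MeasurableSet (Subtype.val '' E) := hV.subtype_image hE
  rw [Measure.add_apply, Measure.sum_apply _ hE, tau_apply hV p _ hE]
  simp only [tau_apply hV p _ hE]
  rw [(MeasurableEmbedding.subtype_coe hV).comap_apply,
    ← hp.2.2 _ hEm ((Subtype.coe_image_subset V E).trans hVU),
    ← measure_iUnion (fun i j hij => Disjoint.set_prod_left (qc_disj ε hij) _ _)
      (fun i => (qc_meas ε i).prod hEm), ← measure_union]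
  · congr 1
    rw [← iUnion_prod_const, qc_union hε, ← union_prod, compl_union_self]
  · rw [← iUnion_prod_const, qc_union hε]
    exact Disjoint.set_prod_left disjoint_compl_left _ _
  · exact MeasurableSet.iUnion fun i => (qc_meas ε i).prod hEm

lemma tau_eta (hV : MeasurableSet V) (hS : MeasurableSet S) (hSU : S ⊆ UHP) {μ ν : Measure Pt}
    (hp : p ∈ Adm μ ν) (f : V → ℝ≥0∞) (hf : Measurable f) (hf1 : ∀ x, f x ≤ 1) :
    ∃ η : Measure Pt, η ≤ μ.restrict S ∧ η univ = ∫⁻ x, f x ∂(tau V p S) := by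
  let e : Pt → ℝ≥0∞ := Function.extend Subtype.val f 0
  have he : Measurable e :=
    (MeasurableEmbedding.subtype_coe hV).measurable_extend hf measurable_zero
  have hev : ∀ x : V, e x = f x := fun x => Subtype.val_injective.extend_apply f 0 x
  have he0 : ∀ x ∉ V, e x = 0 := fun x hx => by
    refine Function.extend_apply' _ _ _ ?_
    rintro ⟨y, rfl⟩
    exact hx y.2
  have he1 : ∀ x, e x ≤ 1 := fun x => by
    by_cases hx : x ∈ V
    · exact (hev ⟨x, hx⟩).trans_le (hf1 _)
    · rw [he0 x hx]; exact zero_le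
  refine ⟨((p.restrict (S ×ˢ univ)).withDensity (fun z => e z.2)).map Prod.fst, ?_, ?_⟩
  · refine Measure.le_iff.2 fun A hA => ?_
    rw [Measure.map_apply measurable_fst hA, withDensity_apply _ (measurable_fst hA),
      Measure.restrict_apply hA, ← hp.2.1 (A ∩ S) (hA.inter hS) (inter_subset_right.trans hSU)]
    calc _ ≤ ∫⁻ z in Prod.fst ⁻¹' A, 1 ∂(p.restrict (S ×ˢ univ)) :=
          lintegral_mono fun z => he1 _
      _ = p ((A ∩ S) ×ˢ univ) := by
          rw [lintegral_one, Measure.restrict_apply_univ,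
            Measure.restrict_apply (measurable_fst hA)]
          congr 1
          ext z
          simp
      _ ≤ _ := le_rfl
  · rw [Measure.map_apply measurable_fst MeasurableSet.univ, preimage_univ,
      withDensity_apply _ MeasurableSet.univ, Measure.restrict_univ]
    have h1 : ∫⁻ x, f x ∂(tau V p S) = ∫⁻ x : V, e x ∂(tau V p S) := by simp only [hev]
    rw [h1, tau, lintegral_subtype_comap hV e, ← lintegral_indicator hV]
    have h2 : V.indicator e = e := by
      ext x
      by_cases hx : x ∈ V
      · simp [hx]
      · simp [hx, he0 x hx]
    rw [h2, lintegral_map he measurable_snd]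

end Tau

section Step
open scoped NNReal CompactlySupported

lemma compact_image_val {V : Set Pt} {K : Set V} (hK : IsCompact K) :
    IsCompact (Subtype.val '' K : Set Pt) := hK.image continuous_subtype_val

lemma limit_step (U : Ultrafilter ℕ) (μs : ℕ → Measure Pt) (V : Set Pt) (hV : IsOpen V)
    (hVU : V ⊆ UHP)
    (hVb : ∀ K : Set Pt, IsCompact K → K ⊆ V →
      ∃ M : ℝ≥0∞, M < ⊤ ∧ ∀ᶠ m in (U : Filter ℕ), μs m K ≤ M)
    (hF : ∀ z ∈ UHP \ V, ∀ r : ℝ, 0 < r → ∀ M : ℝ≥0∞, M < ⊤ →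
      ∀ᶠ m in (U : Filter ℕ), M < μs m (ball z r))
    (hμU : ∀ m, μs m UHPᶜ = 0)
    (b : Measure V) [b.Regular]
    (hb : IsULim U (fun m => (μs m).comap Subtype.val) b)
    (w : Measure Pt) [IsFiniteMeasure w] (hwF : w (UHP \ V)ᶜ = 0)
    (hwp : ∀ z ∈ UHP \ V, ∀ r : ℝ, 0 < r → w (ball z r) ≠ 0)
    {ε : ℝ} (hε : 0 < ε) (ρ0 : Measure Pt) (p : ℕ → Measure (Pt × Pt))
    (hp : ∀ᶠ m in (U : Filter ℕ), p m ∈ Adm ρ0 (μs m) ∧ p m {z | ε < dist z.1 z.2} = 0) :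
    ∃ P ∈ Adm ρ0 (b.map Subtype.val + (⊤ : ℝ≥0∞) • w), P {z | 8 * ε < dist z.1 z.2} = 0 := by
  have hVm := hV.measurableSet
  have hUm : MeasurableSet UHP := uhp_open.measurableSet
  haveI : LocallyCompactSpace V := hV.locallyCompactSpace
  have hval : Measurable (Subtype.val : V → Pt) := measurable_subtype_coe
  -- existence of limits
  have hlim : ∀ S : Set Pt, ∃ c : Measure V, c.Regular ∧ IsULim U (fun m => tau V (p m) S) c := by
    intro S
    refine exists_ulim_measure U _ fun K hK => ?_
    obtain ⟨M, hM, hev⟩ := hVb _ (compact_image_val hK) (Subtype.coe_image_subset V K)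
    refine ⟨M, hM, ?_⟩
    filter_upwards [hev, hp] with m h1 h2
    refine (Measure.le_iff'.1 (tau_le hVm hVU h2.1 S) K).trans ?_
    rw [(MeasurableEmbedding.subtype_coe hVm).comap_apply]
    exact h1
  choose L hLr hL using hlim
  let c : ℕ → Measure V := fun i => L (Qc ε i)
  let d : Measure V := L (Far ε)ᶜ
  haveI : ∀ S, (L S).Regular := hLr
  haveI : ∀ i, (c i).Regular := fun i => hLr _
  have hc : ∀ i, IsULim U (fun m => tau V (p m) (Qc ε i)) (c i) := fun i => hL _
  have hd : IsULim U (fun m => tau V (p m) (Far ε)ᶜ) d := hL _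
  have hsum : b = d + Measure.sum c := by
    refine IsULim.eq_sum hb hc hd ?_ ?_
    · filter_upwards [hp] with m h2
      exact tau_sum hVm hVU h2.1 hε
    · intro K hK
      have hK' : IsCompact (cthickening ε (Subtype.val '' K : Set Pt)) :=
        (compact_image_val hK).cthickening
      obtain ⟨s, hs⟩ := qc_finite hε hK'
      refine ⟨s, ?_⟩
      filter_upwards [hp] with m h2 i hi
      rw [tau_apply hVm _ _ hK.measurableSet]
      refine measure_mono_null ?_ h2.2
      rintro z ⟨hz1, hz2⟩
      by_contra hcon
      refine hi (hs i z.1 hz1 ?_)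
      exact mem_cthickening_of_dist_le _ _ _ _ hz2 (not_lt.1 hcon)
  -- map to Pt
  let β : ℕ → Measure Pt := fun i => (c i).map Subtype.val
  let βR : Measure Pt := d.map Subtype.val
  have hmapU : ∀ e : Measure V, e.map Subtype.val UHPᶜ = 0 := by
    intro e
    rw [Measure.map_apply hval hUm.compl]
    convert measure_empty (μ := e)
    ext x
    simp [hVU x.2]
  have heq : b.map Subtype.val = βR + Measure.sum β := by
    rw [hsum, Measure.map_add _ _ hval, Measure.map_sum hval.aemeasurable]
  rw [heq]
  haveI : ∀ i, SFinite (β i) := fun i => by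
    haveI : SigmaFinite (c i) := inferInstance
    infer_instance
  have hβu : ∀ i, β i univ = c i univ := fun i => by
    rw [Measure.map_apply hval MeasurableSet.univ, preimage_univ]
  refine glue ρ0 hε cc (Qc ε) (qc_meas ε) (qc_disj ε) (qc_ball ε) (qc_union hε) β βR w (UHP \ V)
    ?_ (fun i => hmapU _) ?_ (hmapU _) ?_ hwF ?_ ?_ ?_
  · intro i
    have ho : IsOpen {y : Pt | 2 * ε < dist y (cc i)} :=
      isOpen_lt continuous_const (continuous_id.dist continuous_const)
    rw [Measure.map_apply hval ho.measurableSet]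
    have ho' := ho.preimage (continuous_subtype_val (p := fun x => x ∈ V))
    refine (hc i).null ho' ?_
    filter_upwards [hp] with m h2
    rw [tau_apply hVm _ _ ho'.measurableSet]
    refine measure_mono_null ?_ h2.2
    rintro z ⟨hz1, y, hy, hyz⟩
    have h3 : dist z.1 (cc i) < ε := qc_ball ε i hz1
    have h4 : 2 * ε < dist z.2 (cc i) := by rw [← hyz]; exact hy
    have h5 := dist_triangle_left z.2 (cc i) z.1
    show ε < dist z.1 z.2
    linarith
  · have ho : IsOpen {y : Pt | 3 * ε < persDist y} := isOpen_lt continuous_const pers_cont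
    rw [Measure.map_apply hval ho.measurableSet]
    have ho' := ho.preimage (continuous_subtype_val (p := fun x => x ∈ V))
    refine hd.null ho' ?_
    filter_upwards [hp] with m h2
    rw [tau_apply hVm _ _ ho'.measurableSet]
    refine measure_mono_null ?_ (measure_union_null h2.2 h2.1.1)
    rintro z ⟨hz1, y, hy, hyz⟩
    by_contra hcon
    simp only [mem_union, not_or, mem_compl_iff, not_not] at hcon
    have h3 : dist z.1 z.2 ≤ ε := not_lt.1 hcon.1
    have h4 : 3 * ε < persDist z.2 := by rw [← hyz]; exact hy
    have h5 := pers_le z.2 z.1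
    rw [dist_comm] at h5
    have h6 : 2 * ε < persDist z.1 := by linarith
    exact hz1 ⟨mem_uhp hcon.2.1 (by linarith), h6⟩
  · exact measure_mono_null (compl_subset_compl.2 sdiff_subset) hwF
  · intro i r hr
    rw [hβu] at hr
    obtain ⟨f, hf1, hev⟩ := (hc i).exists_lt hr
    obtain ⟨m, h1, h2⟩ := (hev.and hp).exists
    obtain ⟨η, hη1, hη2⟩ := tau_eta hVm (qc_meas ε i) (fun x hx => hx.2.1) h2.1
      (fun x => (f x : ℝ≥0∞)) (cc_meas f) (fun x => by exact_mod_cast hf1 x)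
    exact ⟨η, hη1, by rw [hη2]; exact h1.2.ne, by rw [hη2]; exact h1.1.le⟩
  · intro i hi
    let K : Set Pt := closedBall (cc i) (2 * ε) ∩ (UHPbar ∩ {x | ε ≤ persDist x})
    have hK : IsCompact K := (isCompact_closedBall _ _).inter_right
      (uhpbar_closed.inter (isClosed_le continuous_const pers_cont))
    have hKV : K ⊆ V := by
      intro x hx
      have hxU : x ∈ UHP := mem_uhp hx.2.1 (hε.trans_le hx.2.2)
      by_contra hxV
      refine hwp x ⟨hxU, hxV⟩ ε hε (measure_mono_null (ball_subset_ball' ?_) hi)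
      have : dist x (cc i) ≤ 2 * ε := hx.1
      linarith
    have hK' : IsCompact (Subtype.val ⁻¹' K : Set V) := by
      rw [Subtype.isCompact_iff, Subtype.image_preimage_coe, inter_eq_right.2 hKV]
      exact hK
    have hle : ∀ᶠ m in (U : Filter ℕ), ρ0 (Qc ε i) ≤ tau V (p m) (Qc ε i) (Subtype.val ⁻¹' K) := by
      filter_upwards [hp] with m h2
      rw [tau_apply hVm _ _ hK'.measurableSet, Subtype.image_preimage_coe, inter_eq_right.2 hKV,
        ← h2.1.2.1 _ (qc_meas ε i) (fun x hx => hx.2.1)]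
      have hN := measure_union_null h2.2 h2.1.1
      refine (measure_mono (t := Qc ε i ×ˢ K ∪ ({z | ε < dist z.1 z.2} ∪ (UHPbar ×ˢ UHPbar)ᶜ)) ?_).trans
        ((measure_union_le _ _).trans (by rw [hN, add_zero]))
      rintro z ⟨hz1, -⟩
      by_contra hcon
      simp only [mem_union, not_or, mem_compl_iff, not_not] at hcon
      have h3 : dist z.1 z.2 ≤ ε := not_lt.1 hcon.2.1
      have h4 : 2 * ε < persDist z.1 := hz1.2.2
      have h5 := pers_le z.1 z.2
      have h6 : dist z.1 (cc i) < ε := qc_ball ε i hz1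
      have h7 := dist_triangle_left z.2 (cc i) z.1
      refine hcon.1 ⟨hz1, ?_, hcon.2.2.2, ?_⟩
      · rw [mem_closedBall]; linarith
      · show ε ≤ persDist z.2
        linarith
    refine ⟨by rw [hβu]; exact (hc i).le_univ hK' hle, ?_⟩
    obtain ⟨M, hM, hev⟩ := hVb K hK hKV
    obtain ⟨m, h1, h2, h3⟩ := (hle.and (hev.and hp)).exists
    refine (h1.trans ?_ |>.trans_lt hM).ne
    refine (Measure.le_iff'.1 (tau_le hVm hVU h3.1 _) _).trans ?_
    rw [(MeasurableEmbedding.subtype_coe hVm).comap_apply, Subtype.image_preimage_coe,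
      inter_eq_right.2 hKV]
    exact h2
  · intro z hz hz5
    have htop : ρ0 (ball z (2 * ε) ∩ UHP) = ⊤ := by
      by_contra hne
      have hlt : ρ0 (ball z (2 * ε) ∩ UHP) < ⊤ := lt_top_iff_ne_top.2 hne
      obtain ⟨m, h1, h2⟩ := ((hF z hz ε hε _ hlt).and hp).exists
      have h3 : μs m (ball z ε) ≤ μs m (ball z ε ∩ UHP) + μs m UHPᶜ := by
        refine (measure_mono ?_).trans (measure_union_le _ _)
        intro x hx
        by_cases hxU : x ∈ UHP
        · exact Or.inl ⟨hx, hxU⟩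
        · exact Or.inr hxU
      rw [hμU, add_zero] at h3
      refine absurd (h1.trans_le h3) (not_lt.2 ?_)
      refine plan_le' h2.1 h2.2 (measurableSet_ball.inter hUm) inter_subset_right
        (measurableSet_ball.inter hUm) inter_subset_right ?_
      intro y hy x hx hxy
      have h4 : dist y z < ε := hy.1
      have h5 : dist x z < 2 * ε := by linarith [dist_triangle x y z]
      refine ⟨h5, mem_uhp hx ?_⟩
      have := pers_le z x
      rw [dist_comm] at this
      linarith
    obtain ⟨s, hs⟩ := qc_finite hε (isCompact_closedBall z (2 * ε))
    by_contra! hcon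
    have hsub : ball z (2 * ε) ∩ UHP ⊆ ⋃ i ∈ s.filter (fun i => dist z (cc i) < 3 * ε), Qc ε i := by
      rintro x ⟨hx, hxU⟩
      have hx' : dist x z < 2 * ε := hx
      have hxF : x ∈ Far ε := by
        refine ⟨hxU, ?_⟩
        show 2 * ε < persDist x
        have := pers_le z x
        rw [dist_comm] at this
        linarith
      rw [← qc_union hε] at hxF
      obtain ⟨i, hi⟩ := mem_iUnion.1 hxF
      refine mem_iUnion₂.2 ⟨i, Finset.mem_filter.2 ⟨hs i x hi (ball_subset_closedBall hx), ?_⟩, hi⟩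
      have h6 : dist x (cc i) < ε := qc_ball ε i hi
      linarith [dist_triangle_left z (cc i) x]
    have hfin : ρ0 (⋃ i ∈ s.filter (fun i => dist z (cc i) < 3 * ε), Qc ε i) < ⊤ := by
      refine measure_biUnion_lt_top (Finset.finite_toSet _) fun i hi => ?_
      have := (Finset.mem_filter.1 hi).2
      refine lt_top_iff_ne_top.2 fun h => ?_
      exact absurd this (not_lt.2 (hcon i h))
    exact absurd (measure_mono hsub) (not_le.2 (by rw [htop]; exact hfin))

end Step

section Final

lemma exists_weight (F : Set Pt) (hFm : MeasurableSet F) :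
    ∃ w : Measure Pt, IsFiniteMeasure w ∧ w Fᶜ = 0 ∧ ∀ z ∈ F, ∀ r : ℝ, 0 < r → w (ball z r) ≠ 0 := by
  rcases F.eq_empty_or_nonempty with rfl | hne
  · exact ⟨0, inferInstance, by simp, by simp⟩
  haveI : Nonempty F := hne.to_subtype
  let g : ℕ → F := TopologicalSpace.denseSeq F
  obtain ⟨q, hq0, hq1⟩ := ENNReal.exists_pos_sum_of_countable (one_ne_zero (α := ℝ≥0∞)) ℕ
  refine ⟨Measure.sum fun k => (q k : ℝ≥0∞) • Measure.dirac (g k : Pt), ⟨?_⟩, ?_, ?_⟩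
  · rw [Measure.sum_apply _ MeasurableSet.univ]
    simp only [Measure.smul_apply, smul_eq_mul, measure_univ, mul_one]
    exact hq1.trans ENNReal.one_lt_top
  · rw [Measure.sum_apply _ hFm.compl]
    simp only [Measure.smul_apply, smul_eq_mul, Measure.dirac_apply' _ hFm.compl]
    simp
  · intro z hz r hr h0
    obtain ⟨k, hk⟩ := (TopologicalSpace.denseRange_denseSeq F).exists_dist_lt ⟨z, hz⟩ hr
    rw [Measure.sum_apply _ measurableSet_ball, ENNReal.tsum_eq_zero] at h0
    have h1 := h0 k
    have hk' : (g k : Pt) ∈ ball z r := by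
      rw [mem_ball, dist_comm]; exact hk
    simp only [Measure.smul_apply, smul_eq_mul, Measure.dirac_apply' _ measurableSet_ball] at h1
    rw [indicator_of_mem hk'] at h1
    simp only [Pi.one_apply, mul_one, ENNReal.coe_eq_zero] at h1
    exact (hq0 k).ne' h1

end Final

/-- (M^∞, OT_∞) is complete. -/
theorem stmt14 (μs : ℕ → Measure Pt) (h : ∀ n, MemMinf (μs n))
    (hC : ∀ ε : ℝ, 0 < ε → ∃ N : ℕ, ∀ m ≥ N, ∀ n ≥ N,
      OTinfE (μs m) (μs n) ≤ ENNReal.ofReal ε) :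
    ∃ μ : Measure Pt, MemMinf μ ∧ Tendsto (fun n => OTinfE (μs n) μ) atTop (𝓝 0) := by
  let U : Ultrafilter ℕ := hyperfilter ℕ
  have hU : ∀ N : ℕ, ∀ᶠ m in (U : Filter ℕ), N ≤ m := fun N =>
    Nat.hyperfilter_le_atTop (eventually_ge_atTop N)
  have hUm : MeasurableSet UHP := uhp_open.measurableSet
  let V : Set Pt := {y | y ∈ UHP ∧ ∃ r : ℝ, 0 < r ∧ ∃ M : ℝ≥0∞, M < ⊤ ∧
    ∀ᶠ m in (U : Filter ℕ), μs m (ball y r) ≤ M}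
  have hVU : V ⊆ UHP := fun y hy => hy.1
  have hV : IsOpen V := by
    rw [isOpen_iff_mem_nhds]
    rintro y ⟨hyU, r, hr, M, hM, hev⟩
    filter_upwards [uhp_open.mem_nhds hyU, ball_mem_nhds y (half_pos hr)] with x hx hxy
    refine ⟨hx, r / 2, half_pos hr, M, hM, ?_⟩
    filter_upwards [hev] with m hm
    refine (measure_mono (ball_subset_ball' ?_)).trans hm
    have : dist x y < r / 2 := hxy
    linarith
  have hVm := hV.measurableSet
  have hVb : ∀ K : Set Pt, IsCompact K → K ⊆ V →
      ∃ M : ℝ≥0∞, M < ⊤ ∧ ∀ᶠ m in (U : Filter ℕ), μs m K ≤ M := by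
    intro K hK hKV
    refine hK.induction_on (p := fun K =>
      ∃ M : ℝ≥0∞, M < ⊤ ∧ ∀ᶠ m in (U : Filter ℕ), μs m K ≤ M) ?_ ?_ ?_ ?_
    · exact ⟨0, by simp, by simp⟩
    · rintro s t hst ⟨M, hM, hev⟩
      exact ⟨M, hM, hev.mono fun m hm => (measure_mono hst).trans hm⟩
    · rintro s t ⟨M, hM, hev⟩ ⟨M', hM', hev'⟩
      refine ⟨M + M', ENNReal.add_lt_top.2 ⟨hM, hM'⟩, ?_⟩
      filter_upwards [hev, hev'] with m h1 h2
      exact (measure_union_le _ _).trans (add_le_add h1 h2)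
    · intro x hx
      obtain ⟨-, r, hr, M, hM, hev⟩ := hKV hx
      exact ⟨ball x r, mem_nhdsWithin_of_mem_nhds (ball_mem_nhds x hr), M, hM, hev⟩
  have hF : ∀ z ∈ UHP \ V, ∀ r : ℝ, 0 < r → ∀ M : ℝ≥0∞, M < ⊤ →
      ∀ᶠ m in (U : Filter ℕ), M < μs m (ball z r) := by
    intro z hz r hr M hM
    by_contra hcon
    rw [← Ultrafilter.eventually_not] at hcon
    refine hz.2 ⟨hz.1, r, hr, M, hM, ?_⟩
    filter_upwards [hcon] with m hm using not_lt.1 hm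
  have hμU : ∀ m, μs m UHPᶜ = 0 := fun m => (h m).1
  haveI : LocallyCompactSpace V := hV.locallyCompactSpace
  have hval : Measurable (Subtype.val : V → Pt) := measurable_subtype_coe
  obtain ⟨b, hbr, hb⟩ := exists_ulim_measure U
    (fun m => (μs m).comap (Subtype.val : V → Pt)) (fun K hK => by
      obtain ⟨M, hM, hev⟩ := hVb _ (compact_image_val hK) (Subtype.coe_image_subset V K)
      refine ⟨M, hM, ?_⟩
      filter_upwards [hev] with m hm
      rw [(MeasurableEmbedding.subtype_coe hVm).comap_apply]
      exact hm)
  have hb' : IsULim U (fun m => (μs m).comap (Subtype.val : V → Pt)) b := hb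
  obtain ⟨w, hwf, hwF, hwp⟩ := exists_weight (UHP \ V) (hUm.diff hVm)
  refine ⟨b.map Subtype.val + (⊤ : ℝ≥0∞) • w, ?_, ?_⟩
  · obtain ⟨N, hN⟩ := hC 1 one_pos
    obtain ⟨C, hC0, hCn⟩ := pers_null_of_mem (h N)
    have ho : IsOpen {x | C + 2 < persDist x} := isOpen_lt continuous_const pers_cont
    have hm : ∀ m ≥ N, μs m {x | C + 2 < persDist x} = 0 := by
      intro m hm
      obtain ⟨p, hp, hpd⟩ := exists_plan zero_le_one one_lt_two (hN N le_rfl m hm)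
      have h1 : μs m ({x | C + 2 < persDist x} ∩ UHP) ≤ μs N ({x | C < persDist x} ∩ UHP) := by
        refine plan_le' hp hpd
          ((isOpen_lt continuous_const pers_cont).inter uhp_open).measurableSet inter_subset_right
          (ho.inter uhp_open).measurableSet inter_subset_right ?_
        intro y hy x hx hxy
        have h2 : C + 2 < persDist y := hy.1
        have h3 := pers_le y x
        rw [dist_comm] at h3
        have h4 : C < persDist x := by linarith
        exact ⟨h4, mem_uhp hx (by linarith)⟩
      rw [measure_mono_null inter_subset_left hCn] at h1
      refine measure_mono_null ?_ (measure_union_null (le_antisymm h1 zero_le) (hμU m))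
      intro x hx
      by_cases hxU : x ∈ UHP
      · exact Or.inl ⟨hx, hxU⟩
      · exact Or.inr hxU
    refine mem_of_pers_null (C := C + 2) ?_ ?_
    · rw [Measure.add_apply, Measure.smul_apply, Measure.map_apply hval hUm.compl,
        measure_mono_null (compl_subset_compl.2 sdiff_subset) hwF]
      have : (Subtype.val : V → Pt) ⁻¹' UHPᶜ = ∅ := by
        ext x
        simp [hVU x.2]
      simp [this]
    · rw [Measure.add_apply, Measure.smul_apply, Measure.map_apply hval ho.measurableSet]
      have e1 : b (Subtype.val ⁻¹' {x | C + 2 < persDist x}) = 0 := by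
        refine hb'.null (ho.preimage continuous_subtype_val) ?_
        filter_upwards [hU N] with m hmN
        rw [(MeasurableEmbedding.subtype_coe hVm).comap_apply]
        exact measure_mono_null (image_preimage_subset _ _) (hm m hmN)
      have e2 : w {x | C + 2 < persDist x} = 0 := by
        refine measure_mono_null ?_ hwF
        intro z hz hzF
        obtain ⟨r, hr, hrs⟩ := Metric.isOpen_iff.1 ho z hz
        obtain ⟨m, h1, h2⟩ := ((hF z hzF r hr 0 (by simp)).and (hU N)).exists
        rw [measure_mono_null hrs (hm m h2)] at h1
        exact lt_irrefl _ h1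
      rw [e1, e2]; simp
  · rw [ENNReal.tendsto_nhds_zero]
    intro δ hδ
    obtain ⟨e, he0, heδ⟩ := ENNReal.lt_iff_exists_real_btwn.1 hδ
    have hepos : 0 < e := by simpa using heδ.1
    obtain ⟨N, hN⟩ := hC (e / 16) (by linarith)
    filter_upwards [eventually_ge_atTop N] with n hn
    have hpl : ∀ m, ∃ p : Measure (Pt × Pt), N ≤ m →
        p ∈ Adm (μs n) (μs m) ∧ p {z | e / 8 < dist z.1 z.2} = 0 := by
      intro m
      by_cases hm : N ≤ m
      · obtain ⟨p, h1, h2⟩ := exists_plan (ε' := e / 8) (by linarith) (by linarith) (hN n hn m hm)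
        exact ⟨p, fun _ => ⟨h1, h2⟩⟩
      · exact ⟨0, fun h => absurd h hm⟩
    choose p hp using hpl
    obtain ⟨P, hP, hPd⟩ := limit_step U μs V hV hVU hVb hF hμU b hb' w hwF hwp
      (ε := e / 8) (by linarith) (μs n) p ((hU N).mono fun m hm => hp m hm)
    refine (iInf₂_le P hP).trans ((costInf_le hPd).trans ?_)
    rw [mul_div_cancel₀ _ (by norm_num)]
    exact heδ.2.le
end
end

section
/- Characterization of bottleneck convergence in D₀^∞: for diagrams a, a₁, a₂, … ∈ D₀^∞, OT_∞(a_n, a) → 0 if and only if a_n → a vaguely and, for every r > 0, the sequence of restrictions a_n^(r) (restriction of a_n to points at distance > r from the diagonal) is tight. -/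
noncomputable section

open MeasureTheory Metric Set Filter Topology ENNReal
open scoped Classical

namespace Stmt17Aux

lemma isClosed_Diag : IsClosed Diag :=
  isClosed_eq (by fun_prop) (by fun_prop)

lemma isOpen_UHP : IsOpen UHP :=
  isOpen_lt (by fun_prop) (by fun_prop)

lemma UHPbar_eq : UHPbar = {x : Pt | x 0 ≤ x 1} := by
  ext x
  simp only [UHPbar, UHP, Diag, mem_union, mem_ofPred_eq]
  exact le_iff_lt_or_eq.symm

lemma isClosed_UHPbar : IsClosed UHPbar := by
  rw [UHPbar_eq]
  exact isClosed_le (by fun_prop) (by fun_prop)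

lemma Diag_nonempty : Diag.Nonempty := ⟨0, by simp [Diag]⟩

lemma continuous_persDist : Continuous persDist := continuous_infDist_pt _

lemma persDist_pos {x : Pt} (hx : x ∈ UHP) : 0 < persDist x := by
  refine (isClosed_Diag.notMem_iff_infDist_pos Diag_nonempty).1 ?_
  intro h
  have h1 : x 0 < x 1 := hx
  have h2 : x 0 = x 1 := h
  linarith

lemma persDist_diag {x : Pt} (hx : x ∈ Diag) : persDist x = 0 := infDist_zero_of_mem hx

lemma mem_UHP_of {x : Pt} (hx : x ∈ UHPbar) (h : 0 < persDist x) : x ∈ UHP := by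
  rcases hx with hx | hx
  · exact hx
  · rw [persDist_diag hx] at h; exact absurd h (lt_irrefl _)

lemma persDist_le (x y : Pt) : persDist x ≤ persDist y + dist x y :=
  infDist_le_infDist_add_dist

/-- orthogonal projection to the diagonal -/
def proj (x : Pt) : Pt := WithLp.toLp 2 ![(x 0 + x 1) / 2, (x 0 + x 1) / 2]

lemma proj_mem (x : Pt) : proj x ∈ Diag := by simp [proj, Diag]

lemma continuous_proj : Continuous proj := by
  unfold proj
  refine (PiLp.continuous_toLp 2 _).comp ?_
  refine continuous_pi fun i => ?_
  fin_cases i <;> simp <;> fun_prop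

lemma dist_proj (x : Pt) : dist x (proj x) ≤ persDist x := by
  refine (le_infDist Diag_nonempty).2 ?_
  intro y hy
  have hy' : y 0 = y 1 := hy
  rw [EuclideanSpace.dist_eq, EuclideanSpace.dist_eq]
  apply Real.sqrt_le_sqrt
  simp only [Fin.sum_univ_two, Real.dist_eq, sq_abs, proj, Matrix.cons_val_zero, Matrix.cons_val_one]
  rw [hy']
  nlinarith [sq_nonneg (x 0 + x 1 - 2 * y 1)]

lemma meas_pers (r : ℝ) : MeasurableSet {x : Pt | r < persDist x} :=
  (isOpen_lt continuous_const continuous_persDist).measurableSet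

lemma compact_pers {K : Set Pt} (hK : IsCompact K) (hKU : K ⊆ UHP) :
    ∃ r : ℝ, 0 < r ∧ ∀ x ∈ K, r < persDist x := by
  rcases K.eq_empty_or_nonempty with rfl | hne
  · exact ⟨1, one_pos, by simp⟩
  obtain ⟨x, hx, hmin⟩ := hK.exists_isMinOn hne continuous_persDist.continuousOn
  have := persDist_pos (hKU hx)
  refine ⟨persDist x / 2, by linarith, fun y hy => ?_⟩
  have : persDist x ≤ persDist y := hmin hy
  linarith

/-- the measure of a compact subset of the half plane is finite -/
lemma compact_fin {μ : Measure Pt} (h0 : ∀ r : ℝ, 0 < r → μ {x | r < persDist x} < ⊤)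
    {K : Set Pt} (hK : IsCompact K) (hKU : K ⊆ UHP) : μ K < ⊤ := by
  obtain ⟨r, hr, h⟩ := compact_pers hK hKU
  exact (measure_mono h).trans_lt (h0 r hr)

lemma diag_null {μ : Measure Pt} (h : IsDiagram μ) : μ UHPᶜ = 0 := by
  obtain ⟨X, n, hX, -, rfl⟩ := h
  rw [Measure.sum_apply _ isOpen_UHP.measurableSet.compl]
  simp only [ENNReal.tsum_eq_zero]
  intro x
  simp [Measure.smul_apply, Measure.dirac_apply, hX x.2]

lemma diag_apply {μ : Measure Pt} (X : Set Pt) (n : Pt → ℕ)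
    (h : μ = Measure.sum (fun x : X => (n x.1 : ℝ≥0∞) • Measure.dirac (x.1 : Pt)))
    {A : Set Pt} (hA : MeasurableSet A) :
    μ A = ∑' x : X, (((if x.1 ∈ A then n x.1 else 0 : ℕ)) : ℝ≥0∞) := by
  rw [h, Measure.sum_apply _ hA]
  congr 1
  ext x
  by_cases hx : x.1 ∈ A <;> simp [Measure.dirac_apply, hx]

lemma fin_supp {ι : Type*} (m : ι → ℕ) (h : ∑' i, (m i : ℝ≥0∞) ≠ ⊤) : {i | m i ≠ 0}.Finite := by
  refine (ENNReal.finite_const_le_of_tsum_ne_top h one_ne_zero).subset ?_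
  intro i hi
  have : 1 ≤ m i := Nat.one_le_iff_ne_zero.2 hi
  show (1 : ℝ≥0∞) ≤ m i
  exact_mod_cast this

lemma diag_nat {μ : Measure Pt} (h : IsDiagram μ) {A : Set Pt} (hA : MeasurableSet A)
    (hf : μ A ≠ ⊤) : ∃ k : ℕ, μ A = k := by
  obtain ⟨X, n, -, -, hμ⟩ := h
  rw [diag_apply X n hμ hA] at hf ⊢
  have hfin := fin_supp _ hf
  refine ⟨∑ i ∈ hfin.toFinset, (if i.1 ∈ A then n i.1 else 0), ?_⟩
  rw [tsum_eq_sum (s := hfin.toFinset)]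
  · push_cast; rfl
  · intro b hb
    have : ¬ ((if b.1 ∈ A then n b.1 else 0) ≠ 0) := by
      intro h'; exact hb (hfin.mem_toFinset.2 h')
    push Not at this
    rw [this]; simp

lemma diag_fin {μ : Measure Pt} (h : IsDiagram μ) {r : ℝ} (hf : μ {x | r < persDist x} < ⊤) :
    ∃ F : Finset Pt, (∀ x ∈ F, x ∈ UHP ∧ r < persDist x ∧ μ {x} ≠ 0) ∧
      μ ({x | r < persDist x} \ F) = 0 := by
  obtain ⟨X, n, hX, -, hμ⟩ := h
  have hf' := hf.ne
  rw [diag_apply X n hμ (meas_pers r)] at hf'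
  have hfin := fin_supp _ hf'
  refine ⟨hfin.toFinset.image Subtype.val, ?_, ?_⟩
  · intro x hx
    simp only [Finset.mem_image, Finite.mem_toFinset, mem_ofPred_eq] at hx
    obtain ⟨y, hy, rfl⟩ := hx
    have h1 : r < persDist y.1 := by
      by_contra hc; simp [hc] at hy
    have h2 : n y.1 ≠ 0 := by
      intro hc; simp [hc] at hy
    refine ⟨hX y.2, h1, ?_⟩
    rw [diag_apply X n hμ (measurableSet_singleton _)]
    intro hc
    rw [ENNReal.tsum_eq_zero] at hc
    have := hc y
    simp at this
    exact h2 this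
  · rw [diag_apply X n hμ ((meas_pers r).diff (Finset.measurableSet _)), ENNReal.tsum_eq_zero]
    intro x
    rw [Nat.cast_eq_zero]
    by_contra hc
    have hm : x.1 ∈ {x | r < persDist x} \ ((hfin.toFinset.image Subtype.val : Finset Pt) : Set Pt) := by
      by_contra hm; exact hc (if_neg hm)
    rw [if_pos hm] at hc
    refine hm.2 ?_
    simp only [Finset.coe_image, Finite.coe_toFinset, mem_image, mem_ofPred_eq]
    exact ⟨x, by simpa [show r < persDist x.1 from hm.1] using hc, rfl⟩

lemma integrable_of {μ : Measure Pt} (h0 : ∀ r : ℝ, 0 < r → μ {x | r < persDist x} < ⊤)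
    {f : Pt → ℝ} (hf : Continuous f) (hc : HasCompactSupport f) (hU : tsupport f ⊆ UHP) :
    Integrable f μ := by
  rw [← integrableOn_iff_integrable_of_support_subset (subset_tsupport f)]
  obtain ⟨C, hC⟩ := hf.bounded_above_of_compact_support hc
  exact Measure.integrableOn_of_bounded (compact_fin h0 hc hU).ne
    hf.aestronglyMeasurable (Eventually.of_forall hC)

lemma null_of_lt_half {μ : Measure Pt} (h : IsDiagram μ) {A : Set Pt} (hA : MeasurableSet A)
    (hf : μ A < 1) : μ A = 0 := by
  obtain ⟨k, hk⟩ := diag_nat h hA (hf.trans one_lt_top).ne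
  rw [hk] at hf ⊢
  have : k < 1 := by exact_mod_cast hf
  have : k = 0 := by omega
  simp [this]

end Stmt17Aux

namespace Stmt17Aux

/-- a plan of small bottleneck cost is concentrated near the diagonal -/
lemma plan_null {π : Measure (Pt × Pt)} {δ : ℝ} (h : CostInf π < ENNReal.ofReal δ) :
    π {z | δ ≤ dist z.1 z.2} = 0 := by
  refine measure_null_of_locally_null _ ?_
  intro z hz
  have hz' : z ∉ msupp π := by
    intro hm
    have h1 : ENNReal.ofReal (dist z.1 z.2) ≤ CostInf π :=
      le_iSup₂_of_le (f := fun z (_ : z ∈ msupp π) => ENNReal.ofReal (dist z.1 z.2)) z hm le_rfl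
    have h2 : ENNReal.ofReal δ ≤ ENNReal.ofReal (dist z.1 z.2) := ENNReal.ofReal_le_ofReal hz
    exact absurd (h2.trans h1) (not_le.2 h)
  simp only [msupp, mem_ofPred_eq, not_forall, not_not] at hz'
  obtain ⟨U, hU, h0⟩ := hz'
  exact ⟨U, mem_nhdsWithin_of_mem_nhds hU, h0⟩

lemma cost_le {π : Measure (Pt × Pt)} {ε : ℝ} (h : π {z | ε < dist z.1 z.2} = 0) :
    CostInf π ≤ ENNReal.ofReal ε := by
  refine iSup₂_le fun z hz => ENNReal.ofReal_le_ofReal ?_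
  by_contra hc
  refine hz {z | ε < dist z.1 z.2} ?_ h
  exact (isOpen_lt continuous_const (by fun_prop)).mem_nhds (not_le.1 hc)

lemma fst_eq {μ ν : Measure Pt} {π : Measure (Pt × Pt)} (hπ : π ∈ Adm μ ν) (hμ : μ UHPᶜ = 0) :
    (π.map Prod.fst).restrict UHP = μ := by
  ext A hA
  have hm := hA.inter isOpen_UHP.measurableSet
  rw [Measure.restrict_apply hA, Measure.map_apply measurable_fst hm,
    ← Set.prod_univ, hπ.2.1 _ hm inter_subset_right]
  exact measure_inter_conull hμ

lemma snd_eq {μ ν : Measure Pt} {π : Measure (Pt × Pt)} (hπ : π ∈ Adm μ ν) (hν : ν UHPᶜ = 0) :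
    (π.map Prod.snd).restrict UHP = ν := by
  ext A hA
  have hm := hA.inter isOpen_UHP.measurableSet
  rw [Measure.restrict_apply hA, Measure.map_apply measurable_snd hm,
    ← Set.univ_prod, hπ.2.2 _ hm inter_subset_right]
  exact measure_inter_conull hν

lemma integral_lift {μ : Measure Pt} {π : Measure (Pt × Pt)} {g : Pt × Pt → Pt}
    (hg : Measurable g) (h : (π.map g).restrict UHP = μ) {f : Pt → ℝ} (hf : Continuous f)
    (hU : tsupport f ⊆ UHP) (hi : Integrable f μ) :
    Integrable (fun z => f (g z)) π ∧ ∫ x, f x ∂μ = ∫ z, f (g z) ∂π := by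
  subst h
  have hs : Function.support f ⊆ UHP := (subset_tsupport f).trans hU
  have h1 : Integrable f (π.map g) := (integrableOn_iff_integrable_of_support_subset hs).1 hi
  refine ⟨(integrable_map_measure hf.aestronglyMeasurable hg.aemeasurable).1 h1, ?_⟩
  rw [setIntegral_eq_integral_of_forall_compl_eq_zero, integral_map hg.aemeasurable
    hf.aestronglyMeasurable]
  intro x hx
  by_contra hc
  exact hx (hs hc)

lemma vague_of_OT (a : Measure Pt) (as : ℕ → Measure Pt)
    (had : IsDiagram a) (ha0 : ∀ r : ℝ, 0 < r → a {x | r < persDist x} < ⊤)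
    (hasd : ∀ n, IsDiagram (as n))
    (has0 : ∀ n, ∀ r : ℝ, 0 < r → (as n) {x | r < persDist x} < ⊤)
    (h : Tendsto (fun n => OTinfE (as n) a) atTop (𝓝 0)) : VagueTendsto as a := by
  intro f hf hc hU
  obtain ⟨r, hr, hrK⟩ := compact_pers hc hU
  have hM := ha0 (r / 2) (by linarith)
  set M : ℝ := (a {x | r / 2 < persDist x}).toReal with hMdef
  have hM0 : 0 ≤ M := ENNReal.toReal_nonneg
  rw [Metric.tendsto_atTop']
  intro ε hε
  have huc := hc.uniformContinuous_of_continuous hf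
  obtain ⟨δ, hδ, hfd⟩ := Metric.uniformContinuous_iff.1 huc (ε / (M + 1)) (by positivity)
  have hd : 0 < min δ (r / 2) := by positivity
  have hev := h.eventually_lt_const (u := ENNReal.ofReal (min δ (r / 2))) (by simpa using hd)
  obtain ⟨N, hN⟩ := eventually_atTop.1 hev
  refine ⟨N, fun n hn => ?_⟩
  have hlt := hN n hn.le
  simp only [OTinfE, iInf_lt_iff] at hlt
  obtain ⟨π, hπ, hcost⟩ := hlt
  have hnull := plan_null hcost
  have hae : ∀ᵐ z ∂π, dist z.1 z.2 < min δ (r / 2) := by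
    rw [ae_iff]; simpa only [not_lt] using hnull
  obtain ⟨i1, e1⟩ := integral_lift measurable_fst (fst_eq hπ (diag_null (hasd n))) hf hU
    (integrable_of (has0 n) hf hc hU)
  obtain ⟨i2, e2⟩ := integral_lift measurable_snd (snd_eq hπ (diag_null had)) hf hU
    (integrable_of ha0 hf hc hU)
  rw [Real.dist_eq, e1, e2, ← integral_sub i1 i2]
  set S : Set (Pt × Pt) := (tsupport f ×ˢ univ) ∪ (univ ×ˢ tsupport f) with hS
  have hbar : ∀ᵐ z ∂π, z ∈ UHPbar ×ˢ UHPbar := by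
    rw [ae_iff]; exact hπ.1
  have hV : MeasurableSet ({x | r / 2 < persDist x} ∩ UHP) :=
    (meas_pers _).inter isOpen_UHP.measurableSet
  have hSle : π S ≤ a {x | r / 2 < persDist x} := by
    calc π S ≤ π (univ ×ˢ ({x | r / 2 < persDist x} ∩ UHP)) := by
          refine measure_mono_ae ?_
          filter_upwards [hae, hbar] with z hz hzb hzS
          have hp : r / 2 < persDist z.2 := by
            rcases hzS with hzS | hzS
            · have h1 := hrK _ hzS.1
              have h2 := persDist_le z.1 z.2
              have h3 := hz.trans_le (min_le_right _ _)
              linarith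
            · have h1 := hrK _ hzS.2
              linarith
          exact ⟨mem_univ _, hp, mem_UHP_of hzb.2 (by linarith)⟩
      _ = a ({x | r / 2 < persDist x} ∩ UHP) := hπ.2.2 _ hV inter_subset_right
      _ ≤ _ := measure_mono inter_subset_left
  have hSm : MeasurableSet S :=
    (hc.isClosed.measurableSet.prod MeasurableSet.univ).union
      (MeasurableSet.univ.prod hc.isClosed.measurableSet)
  have hz : ∀ z ∉ S, f z.1 - f z.2 = 0 := by
    intro z hz
    have h1 : z.1 ∉ tsupport f := fun h' => hz (Or.inl ⟨h', mem_univ _⟩)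
    have h2 : z.2 ∉ tsupport f := fun h' => hz (Or.inr ⟨mem_univ _, h'⟩)
    rw [image_eq_zero_of_notMem_tsupport h1, image_eq_zero_of_notMem_tsupport h2, sub_zero]
  rw [← setIntegral_eq_integral_of_forall_compl_eq_zero hz, ← Real.norm_eq_abs]
  have hb := norm_setIntegral_le_of_norm_le_const_ae (μ := π) (s := S)
    (f := fun z => f z.1 - f z.2) (C := ε / (M + 1)) (hSle.trans_lt hM) (by
      filter_upwards [ae_restrict_of_ae hae] with z hz
      rw [← dist_eq_norm]
      exact (hfd (hz.trans_le (min_le_left _ _))).le)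
  refine hb.trans_lt ?_
  have hle : π.real S ≤ M := ENNReal.toReal_mono hM.ne hSle
  calc ε / (M + 1) * π.real S ≤ ε / (M + 1) * M := by gcongr
    _ < ε / (M + 1) * (M + 1) := by
        have : 0 < ε / (M + 1) := by positivity
        nlinarith
    _ = ε := by field_simp

/-- the compact sets used for tightness -/
def KK (r R : ℝ) : Set Pt := (UHPbar ∩ {x | r ≤ persDist x}) ∩ closedBall 0 R

lemma KK_compact (r R : ℝ) : IsCompact (KK r R) :=
  (isCompact_closedBall _ _).inter_left
    (isClosed_UHPbar.inter (isClosed_le continuous_const continuous_persDist))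

lemma KK_sub {r R : ℝ} (hr : 0 < r) : KK r R ⊆ UHP :=
  fun _ hx => mem_UHP_of hx.1.1 (hr.trans_le hx.1.2)

lemma KK_mono {r R R' : ℝ} (h : R ≤ R') : KK r R ⊆ KK r R' :=
  inter_subset_inter_right _ (closedBall_subset_closedBall h)

lemma tight_one {μ : Measure Pt} (hU : μ UHPᶜ = 0) {r : ℝ} (h0 : μ {x | r < persDist x} < ⊤)
    {ε : ℝ≥0∞} (hε : 0 < ε) : ∃ R : ℕ, μ ({x | r < persDist x} \ KK r R) ≤ ε := by
  have hm : ∀ R : ℕ, MeasurableSet ({x | r < persDist x} \ KK r R) := fun R =>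
    (meas_pers r).diff (KK_compact r R).measurableSet
  have ht := tendsto_measure_iInter_atTop (μ := μ) (s := fun R : ℕ => {x | r < persDist x} \ KK r R)
    (fun R => (hm R).nullMeasurableSet)
    (fun R R' hR => sdiff_subset_sdiff_right (KK_mono (by exact_mod_cast hR)))
    ⟨0, ((measure_mono sdiff_subset).trans_lt h0).ne⟩
  have hz : μ (⋂ R : ℕ, {x | r < persDist x} \ KK r R) = 0 := by
    refine measure_mono_null ?_ hU
    intro x hx hxU
    obtain ⟨R, hR⟩ := exists_nat_ge (dist x 0)
    have h1 := mem_iInter.1 hx R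
    exact h1.2 ⟨⟨Or.inl hxU, show r ≤ persDist x from le_of_lt (show r < persDist x from h1.1)⟩, hR⟩
  rw [hz] at ht
  exact (ENNReal.tendsto_nhds_zero.1 ht ε hε).exists

lemma tight_of_OT (a : Measure Pt) (as : ℕ → Measure Pt)
    (had : IsDiagram a) (ha0 : ∀ r : ℝ, 0 < r → a {x | r < persDist x} < ⊤)
    (hasd : ∀ n, IsDiagram (as n))
    (has0 : ∀ n, ∀ r : ℝ, 0 < r → (as n) {x | r < persDist x} < ⊤)
    (h : Tendsto (fun n => OTinfE (as n) a) atTop (𝓝 0)) (r : ℝ) (hr : 0 < r)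
    (ε : ℝ≥0∞) (hε : 0 < ε) : ∃ K : Set Pt, IsCompact K ∧ K ⊆ UHP ∧
          ∀ n, (as n) ({x | r < persDist x} \ K) ≤ ε := by
  obtain ⟨R0, hR0⟩ := tight_one (diag_null had) (ha0 (r / 2) (by linarith)) hε
  choose R hR using fun n => tight_one (diag_null (hasd n)) (has0 n r hr) hε
  have hev := h.eventually_lt_const (u := ENNReal.ofReal (min 1 (r / 2))) (by simpa using hr)
  obtain ⟨N, hN⟩ := eventually_atTop.1 hev
  set Q : ℝ := (R0 : ℝ) + 1 + ∑ i ∈ Finset.range N, (R i : ℝ) with hQ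
  have hsum : 0 ≤ ∑ i ∈ Finset.range N, (R i : ℝ) := by positivity
  refine ⟨KK r Q, KK_compact _ _, KK_sub hr, fun n => ?_⟩
  rcases lt_or_ge n N with hn | hn
  · refine (measure_mono (sdiff_subset_sdiff_right (KK_mono ?_))).trans (hR n)
    have : (R n : ℝ) ≤ ∑ i ∈ Finset.range N, (R i : ℝ) :=
      Finset.single_le_sum (f := fun i => (R i : ℝ)) (fun i _ => by positivity)
        (Finset.mem_range.2 hn)
    have h0 : (0 : ℝ) ≤ R0 := by positivity
    linarith
  · have hlt := hN n hn
    simp only [OTinfE, iInf_lt_iff] at hlt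
    obtain ⟨π, hπ, hcost⟩ := hlt
    have hae : ∀ᵐ z ∂π, dist z.1 z.2 < min 1 (r / 2) := by
      rw [ae_iff]; simpa only [not_lt] using plan_null hcost
    have hbar : ∀ᵐ z ∂π, z ∈ UHPbar ×ˢ UHPbar := by
      rw [ae_iff]; exact hπ.1
    have hA : MeasurableSet (({x | r < persDist x} \ KK r Q) ∩ UHP) :=
      ((meas_pers r).diff (KK_compact r Q).measurableSet).inter isOpen_UHP.measurableSet
    have hB : MeasurableSet (({x | r / 2 < persDist x} \ KK (r / 2) R0) ∩ UHP) :=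
      ((meas_pers _).diff (KK_compact _ _).measurableSet).inter isOpen_UHP.measurableSet
    calc as n ({x | r < persDist x} \ KK r Q)
        = as n (({x | r < persDist x} \ KK r Q) ∩ UHP) :=
          (measure_inter_conull (diag_null (hasd n))).symm
      _ = π ((({x | r < persDist x} \ KK r Q) ∩ UHP) ×ˢ univ) :=
          (hπ.2.1 _ hA inter_subset_right).symm
      _ ≤ π (univ ×ˢ (({x | r / 2 < persDist x} \ KK (r / 2) R0) ∩ UHP)) := by
          refine measure_mono_ae ?_
          filter_upwards [hae, hbar] with z hz hzb hzS
          obtain ⟨⟨⟨h1, h2⟩, h3⟩, -⟩ := hzS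
          have h1' : r < persDist z.1 := h1
          have h4 := persDist_le z.1 z.2
          have h5 := hz.trans_le (min_le_right _ _)
          have h6 := hz.trans_le (min_le_left _ _)
          have h7 : r / 2 < persDist z.2 := by linarith
          refine ⟨mem_univ _, ⟨h7, fun hk => h2 ?_⟩, mem_UHP_of hzb.2 (by linarith)⟩
          refine ⟨⟨hzb.1, h1'.le⟩, ?_⟩
          have h8 : dist z.2 0 ≤ R0 := hk.2
          have h9 := dist_triangle z.1 z.2 0
          show dist z.1 0 ≤ Q
          linarith
      _ = a (({x | r / 2 < persDist x} \ KK (r / 2) R0) ∩ UHP) := hπ.2.2 _ hB inter_subset_right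
      _ ≤ a ({x | r / 2 < persDist x} \ KK (r / 2) R0) := measure_mono inter_subset_left
      _ ≤ ε := hR0

end Stmt17Aux

namespace Stmt17Aux

lemma ev_null {a : Measure Pt} {as : ℕ → Measure Pt}
    (had : IsDiagram a) (ha0 : ∀ r : ℝ, 0 < r → a {x | r < persDist x} < ⊤)
    (hasd : ∀ n, IsDiagram (as n))
    (has0 : ∀ n, ∀ r : ℝ, 0 < r → (as n) {x | r < persDist x} < ⊤)
    (h : VagueTendsto as a) {K : Set Pt} (hK : IsCompact K) (hKU : K ⊆ UHP) (hK0 : a K = 0) :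
    ∀ᶠ n in atTop, as n K = 0 := by
  obtain ⟨r, hr, hrK⟩ := compact_pers hK hKU
  obtain ⟨F, hF, hF0⟩ := diag_fin had (ha0 r hr)
  have hUo : IsOpen ((UHP ∩ {x | r < persDist x}) \ (F : Set Pt)) :=
    (isOpen_UHP.inter (isOpen_lt continuous_const continuous_persDist)).sdiff
      F.finite_toSet.isClosed
  have hKsub : K ⊆ (UHP ∩ {x | r < persDist x}) \ (F : Set Pt) := by
    intro x hx
    refine ⟨⟨hKU hx, hrK x hx⟩, fun hxF => (hF x hxF).2.2 ?_⟩
    exact measure_mono_null (singleton_subset_iff.2 hx) hK0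
  obtain ⟨f, hf1, hfc, hfU, hf01⟩ :=
    exists_continuousMap_one_of_isCompact_subset_isOpen hK hUo hKsub
  have hfU' : tsupport f ⊆ UHP := fun x hx => (hfU hx).1.1
  have ht := h f f.continuous hfc hfU'
  have hz : ∫ x, f x ∂a = 0 := by
    refine integral_eq_zero_of_ae ?_
    have hn : a (tsupport f) = 0 :=
      measure_mono_null (fun x hx => (⟨(hfU hx).1.2, (hfU hx).2⟩ : x ∈ {x | r < persDist x} \ (F : Set Pt))) hF0
    rw [Filter.EventuallyEq, ae_iff]
    exact measure_mono_null (fun x hx => subset_tsupport f hx) hn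
  rw [hz] at ht
  filter_upwards [ht.eventually_lt_const (u := 1) one_pos] with n hn
  refine null_of_lt_half (hasd n) hK.measurableSet ?_
  have hKf := compact_fin (has0 n) hK hKU
  have hle : (as n).real K ≤ ∫ x, f x ∂(as n) := by
    rw [← integral_indicator_one hK.measurableSet]
    refine integral_mono ?_ (integrable_of (has0 n) f.continuous hfc hfU') ?_
    · exact (integrable_indicator_iff hK.measurableSet).2
        (integrableOn_const (hs := hKf.ne))
    · intro x
      by_cases hx : x ∈ K
      · simp [hx, hf1 hx]
      · simpa [hx] using (hf01 x).1
  have := (hle.trans_lt hn)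
  rw [← ENNReal.toReal_lt_toReal hKf.ne one_ne_top]
  rw [ENNReal.toReal_one]; exact this

lemma ev_ball {a : Measure Pt} {as : ℕ → Measure Pt}
    (had : IsDiagram a) (ha0 : ∀ r : ℝ, 0 < r → a {x | r < persDist x} < ⊤)
    (hasd : ∀ n, IsDiagram (as n))
    (has0 : ∀ n, ∀ r : ℝ, 0 < r → (as n) {x | r < persDist x} < ⊤)
    (h : VagueTendsto as a) {x : Pt} {η : ℝ} (hη : 0 < η)
    (hU : closedBall x η ⊆ UHP) (h0 : a (closedBall x η \ {x}) = 0) :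
    ∀ᶠ n in atTop, as n (ball x η) = a {x} := by
  set C : Set Pt := closedBall x η \ ball x (η / 2) with hC
  have hCc : IsCompact C := (isCompact_closedBall x η).diff isOpen_ball
  have hC0 : a C = 0 := by
    refine measure_mono_null (sdiff_subset_sdiff_right ?_) h0
    simpa using hη
  have hCU : C ⊆ UHP := sdiff_subset.trans hU
  obtain ⟨f, hf1, hfc, hfU, hf01⟩ :=
    exists_continuousMap_one_of_isCompact_subset_isOpen (isCompact_closedBall x (η / 2))
      (isOpen_ball (x := x) (ε := η)) (closedBall_subset_ball (by linarith))
  have hfU' : tsupport f ⊆ UHP := hfU.trans (ball_subset_closedBall.trans hU)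
  have ht := h f f.continuous hfc hfU'
  have key : ∀ μ : Measure Pt, μ C = 0 → ∫ y, f y ∂μ = μ.real (ball x η) := by
    intro μ hμ
    rw [← integral_indicator_one measurableSet_ball]
    refine integral_congr_ae ?_
    rw [Filter.EventuallyEq, ae_iff]
    refine measure_mono_null ?_ hμ
    intro y hy
    by_contra hyC
    apply hy
    by_cases hb : y ∈ ball x η
    · have : y ∈ closedBall x (η / 2) := by
        by_contra hc
        exact hyC ⟨ball_subset_closedBall hb, fun h' => hc (ball_subset_closedBall h')⟩
      simp [hb, hf1 this]
    · rw [indicator_of_notMem hb]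
      exact image_eq_zero_of_notMem_tsupport (fun h' => hb (hfU h'))
  have hab : a (ball x η) = a {x} := by
    refine le_antisymm ?_ (measure_mono (by simpa using hη))
    calc a (ball x η) ≤ a ({x} ∪ (closedBall x η \ {x})) := by
          refine measure_mono fun y hy => ?_
          by_cases hyx : y = x
          · exact Or.inl hyx
          · exact Or.inr ⟨ball_subset_closedBall hy, hyx⟩
      _ ≤ a {x} + a (closedBall x η \ {x}) := measure_union_le _ _
      _ = a {x} := by rw [h0, add_zero]
  have hfin : ∀ μ : Measure Pt, (∀ r : ℝ, 0 < r → μ {x | r < persDist x} < ⊤) →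
      μ (ball x η) ≠ ⊤ := fun μ hμ =>
    ((measure_mono ball_subset_closedBall).trans_lt
      (compact_fin hμ (isCompact_closedBall x η) hU)).ne
  rw [key a hC0] at ht
  obtain ⟨k, hk⟩ := diag_nat had measurableSet_ball (hfin a ha0)
  have hz := ev_null had ha0 hasd has0 h hCc hCU hC0
  filter_upwards [hz, Metric.tendsto_nhds.1 ht 1 one_pos] with n hn hd
  rw [key _ hn] at hd
  obtain ⟨m, hm⟩ := diag_nat (hasd n) measurableSet_ball (hfin _ (has0 n))
  rw [← hab, hm, hk]
  simp only [Measure.real, hm, hk, ENNReal.toReal_natCast, Real.dist_eq] at hd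
  have hd' : |(m : ℤ) - k| < 1 := by exact_mod_cast hd
  have : m = k := by
    rw [abs_lt] at hd'
    omega
  rw [this]

lemma exists_radius (F : Finset Pt) (V : Pt → Set Pt) (hV : ∀ x ∈ F, V x ∈ 𝓝 x) {ε : ℝ}
    (hε : 0 < ε) : ∃ η : ℝ, 0 < η ∧ η < ε ∧ (∀ x ∈ F, closedBall x η ⊆ V x) ∧
      (∀ x ∈ F, ∀ y ∈ F, x ≠ y → Disjoint (ball x η) (ball y η)) := by
  have h1 : ∀ᶠ η : ℝ in 𝓝[>] 0, 0 < η := self_mem_nhdsWithin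
  have h2 : ∀ c : ℝ, 0 < c → ∀ᶠ η : ℝ in 𝓝[>] 0, η < c := fun c hc =>
    nhdsWithin_le_nhds (eventually_lt_nhds hc)
  have h3 : ∀ᶠ η : ℝ in 𝓝[>] 0, ∀ x ∈ F, closedBall x η ⊆ V x := by
    rw [eventually_all_finset]
    intro x hx
    obtain ⟨c, hc, hcV⟩ := Metric.nhds_basis_closedBall.mem_iff.1 (hV x hx)
    filter_upwards [h2 c hc] with η hη
    exact (closedBall_subset_closedBall hη.le).trans hcV
  have h4 : ∀ᶠ η : ℝ in 𝓝[>] 0, ∀ x ∈ F, ∀ y ∈ F, x ≠ y → Disjoint (ball x η) (ball y η) := by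
    rw [eventually_all_finset]
    intro x hx
    rw [eventually_all_finset]
    intro y hy
    by_cases hxy : x = y
    · exact Eventually.of_forall fun η hn => absurd hxy hn
    filter_upwards [h2 (dist x y / 2) (by have := dist_pos.2 hxy; linarith)] with η hη _
    exact ball_disjoint_ball (by linarith)
  obtain ⟨η, e1, e2, e3, e4⟩ := (h1.and ((h2 ε hε).and (h3.and h4))).exists
  exact ⟨η, e1, e2, e3, e4⟩

/-- the explicit plan -/
def plan (μ ν : Measure Pt) (F : Finset Pt) (η : ℝ) : Measure (Pt × Pt) :=
  (∑ c ∈ F, (μ.restrict (ball c η)).map (fun x => (x, c))) +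
  ((μ.restrict (⋃ c ∈ F, ball c η)ᶜ).map (fun x => (x, proj x)) +
    (ν.restrict (F : Set Pt)ᶜ).map (fun y => (proj y, y)))

lemma meas_U (F : Finset Pt) (η : ℝ) : MeasurableSet (⋃ c ∈ F, ball c η) :=
  F.measurableSet_biUnion fun _ _ => measurableSet_ball

lemma meas_l : Measurable (fun x : Pt => (x, proj x)) :=
  measurable_id.prodMk continuous_proj.measurable

lemma meas_r : Measurable (fun x : Pt => (proj x, x)) :=
  continuous_proj.measurable.prodMk measurable_id

lemma plan_apply (μ ν : Measure Pt) (F : Finset Pt) (η : ℝ) {S : Set (Pt × Pt)}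
    (hS : MeasurableSet S) : plan μ ν F η S =
      (∑ c ∈ F, μ ({x | (x, c) ∈ S} ∩ ball c η)) +
      (μ ({x | (x, proj x) ∈ S} ∩ (⋃ c ∈ F, ball c η)ᶜ) +
        ν ({y | (proj y, y) ∈ S} ∩ (F : Set Pt)ᶜ)) := by
  have hl : ∀ c : Pt, Measurable (fun x : Pt => (x, c)) := fun c => by fun_prop
  rw [plan, Measure.add_apply, Measure.add_apply, Measure.finsetSum_apply,
    Measure.map_apply meas_l hS, Measure.map_apply meas_r hS,
    Measure.restrict_apply (meas_l hS), Measure.restrict_apply (meas_r hS)]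
  congr 1
  refine Finset.sum_congr rfl fun c _ => ?_
  rw [Measure.map_apply (hl c) hS, Measure.restrict_apply (hl c hS)]
  rfl

lemma diag_not {x : Pt} (h : x ∈ Diag) (h' : x ∈ UHP) : False := by
  have h1 := persDist_pos h'
  rw [persDist_diag h] at h1
  exact lt_irrefl _ h1

lemma plan_adm {μ ν : Measure Pt} {F : Finset Pt} {η : ℝ} (hμ : μ UHPᶜ = 0) (hν : ν UHPᶜ = 0)
    (hF : ∀ c ∈ F, c ∈ UHP)
    (hdis : ∀ x ∈ F, ∀ y ∈ F, x ≠ y → Disjoint (ball x η) (ball y η))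
    (hm : ∀ c ∈ F, μ (ball c η) = ν {c}) : plan μ ν F η ∈ Adm μ ν := by
  refine ⟨?_, ?_, ?_⟩
  · rw [plan_apply _ _ _ _ (isClosed_UHPbar.prod isClosed_UHPbar).measurableSet.compl]
    have e1 : ∀ c ∈ F, μ ({x | (x, c) ∈ (UHPbar ×ˢ UHPbar)ᶜ} ∩ ball c η) = 0 := by
      intro c hc
      refine measure_mono_null ?_ hμ
      intro x hx hxU
      exact hx.1 ⟨Or.inl hxU, Or.inl (hF c hc)⟩
    rw [Finset.sum_eq_zero e1, zero_add, add_eq_zero]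
    refine ⟨measure_mono_null ?_ hμ, measure_mono_null ?_ hν⟩
    · intro x hx hxU
      exact hx.1 ⟨Or.inl hxU, Or.inr (proj_mem x)⟩
    · intro x hx hxU
      exact hx.1 ⟨Or.inr (proj_mem x), Or.inl hxU⟩
  · intro A hA hAU
    rw [plan_apply _ _ _ _ (hA.prod MeasurableSet.univ)]
    have e3 : {y | (proj y, y) ∈ A ×ˢ (univ : Set Pt)} ∩ (F : Set Pt)ᶜ = ∅ := by
      ext y
      simp only [mem_inter_iff, mem_empty_iff_false, iff_false]
      rintro ⟨h1, -⟩
      exact diag_not (proj_mem y) (hAU h1.1)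
    have e2 : {x | (x, proj x) ∈ A ×ˢ (univ : Set Pt)} = A := by
      ext x; simp
    have e1 : ∀ c : Pt, {x | (x, c) ∈ A ×ˢ (univ : Set Pt)} = A := by
      intro c; ext x; simp
    simp only [e1, e2, e3, measure_empty, add_zero]
    rw [← measure_biUnion_finset, ← measure_inter_add_sdiff A (meas_U F η), inter_iUnion₂]
    · rfl
    · intro x hx y hy hxy
      exact (hdis x hx y hy hxy).mono inter_subset_right inter_subset_right
    · intro c _
      exact hA.inter measurableSet_ball
  · intro B hB hBU
    rw [plan_apply _ _ _ _ (MeasurableSet.univ.prod hB)]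
    have e2 : {x | (x, proj x) ∈ (univ : Set Pt) ×ˢ B} ∩ (⋃ c ∈ F, ball c η)ᶜ = ∅ := by
      ext y
      simp only [mem_inter_iff, mem_empty_iff_false, iff_false]
      rintro ⟨h1, -⟩
      exact diag_not (proj_mem y) (hBU h1.2)
    have e3 : {x | (proj x, x) ∈ (univ : Set Pt) ×ˢ B} = B := by
      ext x; simp
    have e1 : ∀ c ∈ F, μ ({x | (x, c) ∈ (univ : Set Pt) ×ˢ B} ∩ ball c η) = ν (B ∩ {c}) := by
      intro c hc
      by_cases hcB : c ∈ B
      · have : {x : Pt | (x, c) ∈ (univ : Set Pt) ×ˢ B} = univ := by ext; simp [hcB]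
        rw [this, univ_inter, hm c hc, inter_eq_right.2 (singleton_subset_iff.2 hcB)]
      · have : {x : Pt | (x, c) ∈ (univ : Set Pt) ×ˢ B} = ∅ := by ext; simp [hcB]
        rw [this, empty_inter, inter_singleton_eq_empty.2 hcB, measure_empty, measure_empty]
    rw [Finset.sum_congr rfl e1, e2, e3, measure_empty, zero_add, ← measure_biUnion_finset,
      ← measure_inter_add_sdiff B F.measurableSet, ← inter_iUnion₂]
    · have : (⋃ i ∈ F, {i}) = (F : Set Pt) := by ext; simp
      rw [this]; rfl
    · intro x hx y hy hxy
      refine Disjoint.mono inter_subset_right inter_subset_right ?_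
      simpa using hxy
    · intro c _
      exact hB.inter (measurableSet_singleton c)

lemma plan_cost {μ ν : Measure Pt} {F : Finset Pt} {η ε : ℝ} (hη : η ≤ ε)
    (h1 : μ ({x | ε < persDist x} \ ⋃ c ∈ F, ball c η) = 0)
    (h2 : ν ({x | ε < persDist x} \ F) = 0) :
    CostInf (plan μ ν F η) ≤ ENNReal.ofReal ε := by
  refine cost_le ?_
  have hm : MeasurableSet {z : Pt × Pt | ε < dist z.1 z.2} :=
    (isOpen_lt continuous_const (by fun_prop)).measurableSet
  rw [plan_apply _ _ _ _ hm, Finset.sum_eq_zero, zero_add, add_eq_zero]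
  · refine ⟨measure_mono_null ?_ h1, measure_mono_null ?_ h2⟩
    · intro x hx
      have hx1 : ε < dist x (proj x) := hx.1
      exact ⟨show ε < persDist x from lt_of_lt_of_le hx1 (dist_proj x), hx.2⟩
    · intro x hx
      have hx1 : ε < dist (proj x) x := hx.1
      rw [dist_comm] at hx1
      exact ⟨show ε < persDist x from lt_of_lt_of_le hx1 (dist_proj x), hx.2⟩
  · intro c _
    convert measure_empty (μ := μ)
    ext x
    simp only [mem_inter_iff, mem_empty_iff_false, iff_false]
    rintro ⟨h, h'⟩
    have a1 : ε < dist x c := h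
    have a2 : dist x c < η := h'
    linarith

lemma OT_of (a : Measure Pt) (as : ℕ → Measure Pt)
    (had : IsDiagram a) (ha0 : ∀ r : ℝ, 0 < r → a {x | r < persDist x} < ⊤)
    (hasd : ∀ n, IsDiagram (as n))
    (has0 : ∀ n, ∀ r : ℝ, 0 < r → (as n) {x | r < persDist x} < ⊤)
    (hv : VagueTendsto as a)
    (ht : ∀ r : ℝ, 0 < r → ∀ ε : ℝ, 0 < ε → ∃ K : Set Pt, IsCompact K ∧ K ⊆ UHP ∧
          ∀ n, (as n) ({x | r < persDist x} \ K) ≤ ENNReal.ofReal ε)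
    (ε : ℝ) (hε : 0 < ε) : ∀ᶠ n in atTop, OTinfE (as n) a ≤ ENNReal.ofReal ε := by
  obtain ⟨K, hK, hKU, hKt⟩ := ht ε hε (1 / 2) (by norm_num)
  have hKt' : ∀ n, as n ({x | ε < persDist x} \ K) = 0 := fun n => by
    refine null_of_lt_half (hasd n) ((meas_pers ε).diff hK.measurableSet)
      ((hKt n).trans_lt ?_)
    rw [ENNReal.ofReal_lt_one]; norm_num
  obtain ⟨F, hF, hF0⟩ := diag_fin had (ha0 (ε / 2) (by linarith))
  obtain ⟨η, hη, hηε, hV, hdis⟩ := exists_radius F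
    (fun x => (UHP ∩ {y | ε / 2 < persDist y}) \ ((F : Set Pt) \ {x})) (by
      intro x hx
      refine IsOpen.mem_nhds ?_ ⟨⟨(hF x hx).1, (hF x hx).2.1⟩, fun h => h.2 rfl⟩
      exact (isOpen_UHP.inter (isOpen_lt continuous_const continuous_persDist)).sdiff
        (F.finite_toSet.subset sdiff_subset).isClosed) hε
  have hball : ∀ᶠ n in atTop, ∀ c ∈ F, as n (ball c η) = a {c} := by
    rw [eventually_all_finset]
    intro c hc
    refine ev_ball had ha0 hasd has0 hv hη (fun y hy => (hV c hc hy).1.1) ?_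
    refine measure_mono_null ?_ hF0
    intro y hy
    have := hV c hc hy.1
    exact ⟨this.1.2, fun hyF => this.2 ⟨hyF, hy.2⟩⟩
  have hFU : (F : Set Pt) ⊆ ⋃ c ∈ F, ball c η := by
    intro c hc
    exact mem_iUnion₂.2 ⟨c, hc, mem_ball_self hη⟩
  have hK' : IsCompact ((K ∩ {x | ε ≤ persDist x}) \ ⋃ c ∈ F, ball c η) :=
    (hK.inter_right (isClosed_le continuous_const continuous_persDist)).diff
      (isOpen_biUnion fun _ _ => isOpen_ball)
  have hK'0 : a ((K ∩ {x | ε ≤ persDist x}) \ ⋃ c ∈ F, ball c η) = 0 := by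
    refine measure_mono_null ?_ hF0
    intro x hx
    have h1 : ε ≤ persDist x := hx.1.2
    exact ⟨show ε / 2 < persDist x by linarith, fun h => hx.2 (hFU h)⟩
  filter_upwards [hball, ev_null had ha0 hasd has0 hv hK' (fun x hx => hKU hx.1.1) hK'0]
    with n hn1 hn2
  refine (iInf₂_le (plan (as n) a F η) (plan_adm (diag_null (hasd n)) (diag_null had)
    (fun c hc => (hF c hc).1) hdis hn1)).trans (plan_cost hηε.le ?_ ?_)
  · refine measure_mono_null ?_ (measure_union_null (hKt' n) hn2)
    intro x hx
    by_cases hxK : x ∈ K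
    · exact Or.inr ⟨⟨hxK, le_of_lt (show ε < persDist x from hx.1)⟩, hx.2⟩
    · exact Or.inl ⟨hx.1, hxK⟩
  · refine measure_mono_null ?_ hF0
    intro x hx
    have h1 : ε < persDist x := hx.1
    exact ⟨show ε / 2 < persDist x by linarith, hx.2⟩

end Stmt17Aux

/-- for diagrams in D₀^∞, bottleneck convergence OT_∞(a_n,a) → 0
holds iff a_n → a vaguely and, for every r > 0, the restrictions of a_n to the
points of persistence > r form a tight sequence. -/
theorem stmt17 (a : Measure Pt) (as : ℕ → Measure Pt)
    (had : IsDiagram a) (ha0 : ∀ r : ℝ, 0 < r → a {x | r < persDist x} < ⊤)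
    (hasd : ∀ n, IsDiagram (as n))
    (has0 : ∀ n, ∀ r : ℝ, 0 < r → (as n) {x | r < persDist x} < ⊤) :
    Tendsto (fun n => OTinfE (as n) a) atTop (𝓝 0) ↔
      (VagueTendsto as a ∧
        ∀ r : ℝ, 0 < r → ∀ ε : ℝ, 0 < ε → ∃ K : Set Pt, IsCompact K ∧ K ⊆ UHP ∧
          ∀ n, (as n) ({x | r < persDist x} \ K) ≤ ENNReal.ofReal ε) := by
  constructor
  · intro h
    refine ⟨Stmt17Aux.vague_of_OT a as had ha0 hasd has0 h, fun r hr ε hε => ?_⟩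
    exact Stmt17Aux.tight_of_OT a as had ha0 hasd has0 h r hr _ (ENNReal.ofReal_pos.2 hε)
  · rintro ⟨hv, ht⟩
    rw [ENNReal.tendsto_nhds_zero]
    intro ε hε
    obtain ⟨δ, hδ, hδε⟩ := ENNReal.lt_iff_exists_real_btwn.1 hε
    have hδ0 : 0 < δ := ENNReal.ofReal_pos.1 hδε.1
    filter_upwards [Stmt17Aux.OT_of a as had ha0 hasd has0 hv ht δ hδ0] with n hn
    exact hn.trans hδε.2.le
end
end
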